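/- arXiv:1710.07456 — 14 statements merged into one kernel-verified Lean document; each statement's English description precedes it below -/
import Mathlib

section
/- Let F ⊆ Hom(P,ℕ) be a poset filter. Then the collection of ascents {Λφ : φ ∈ F} has only finitely many inclusion-minimal members, i.e. the set of those Λφ (φ ∈ F) that are minimal under set inclusion among all Λψ with ψ ∈ F is finite. -/
open MvPolynomial
open scoped Classical

/-- The ascent of an isotone map `φ : P → ℕ`:
`Λφ = {(p,i) : i < φ(p) and φ(q) ≤ i for all q < p}`. -/
def ascent {P : Type*} [PartialOrder P] (φ : P →o ℕ) : Set (P × ℕ) :=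
  {x | x.2 < φ x.1 ∧ ∀ q < x.1, φ q ≤ x.2}

/-- The graph of an isotone map `φ : P → ℕ`: `Γφ = {(p,i) : φ(p) = i}`. -/
def graphOf {P : Type*} [PartialOrder P] (φ : P →o ℕ) : Set (P × ℕ) :=
  {x | φ x.1 = x.2}

/-- A poset ideal: a downward closed subset of a poset. -/
def IsPosetIdeal {Q : Type*} [Preorder Q] (I : Set Q) : Prop :=
  ∀ q ∈ I, ∀ q' ≤ q, q' ∈ I

/-- A marker for a poset ideal `J ⊆ Hom(P,ℕ)`: a poset ideal `I ⊆ P` together with an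
isotone map `α : I → ℕ` such that every isotone `φ : P → ℕ` restricting to `α` on `I`
lies in `J`. -/
def IsMarker {P : Type*} [PartialOrder P] (J : Set (P →o ℕ)) (I : Set P) (α : I → ℕ) : Prop :=
  IsPosetIdeal I ∧ Monotone α ∧ ∀ φ : P →o ℕ, (∀ p : I, φ p = α p) → φ ∈ J

/-- A minimal marker: no restriction to a properly contained poset ideal is a marker. -/
def IsMinimalMarker {P : Type*} [PartialOrder P] (J : Set (P →o ℕ)) (I : Set P)
    (α : I → ℕ) : Prop :=
  IsMarker J I α ∧ ∀ (I' : Set P) (h : I' ⊆ I), I' ≠ I →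
    ¬ IsMarker J I' (fun p => α ⟨p.1, h p.2⟩)

/-- The graph of a marker `α : I → ℕ`. -/
def markerGraph {P : Type*} [PartialOrder P] (I : Set P) (α : I → ℕ) : Set (P × ℕ) :=
  Set.range fun p : I => ((p : P), α p)

lemma ascent_finite {P : Type*} [PartialOrder P] [Fintype P] (φ : P →o ℕ) :
    (ascent φ).Finite := by
  apply Set.Finite.subset
    ((Set.finite_univ (α := P)).prod (Set.finite_Iio (Finset.univ.sup (fun p => φ p) + 1)))
  rintro ⟨p, i⟩ hpi
  exact ⟨trivial, (lt_of_lt_of_le hpi.1 (Finset.le_sup (Finset.mem_univ p))).trans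
    (Nat.lt_succ_self _)⟩

/-- `Λ̄φ : P → ℕ`, the multiplicity function of the ascent under projection to `P`. -/
noncomputable def lambdaBar {P : Type*} [PartialOrder P] (φ : P →o ℕ) : P → ℕ :=
  fun p => {i : ℕ | (p, i) ∈ ascent φ}.ncard

/-- The truncation `p ↦ min (φ p) N` of an isotone map. -/
def truncate {P : Type*} [PartialOrder P] (φ : P →o ℕ) (N : ℕ) : P →o ℕ where
  toFun p := min (φ p) N
  monotone' _ _ h := min_le_min_right N (φ.monotone h)

lemma mem_ascent_truncate {P : Type*} [PartialOrder P] (φ : P →o ℕ) (N : ℕ) (x : P × ℕ) :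
    x ∈ ascent (truncate φ N) ↔ x ∈ ascent φ ∧ x.2 < N := by
  change (x.2 < min (φ x.1) N ∧ ∀ q < x.1, min (φ q) N ≤ x.2) ↔
    (x.2 < φ x.1 ∧ ∀ q < x.1, φ q ≤ x.2) ∧ x.2 < N
  constructor
  · rintro ⟨h, hq⟩
    rw [lt_min_iff] at h
    exact ⟨⟨h.1, fun q hqx => (min_le_iff.1 (hq q hqx)).resolve_right h.2.not_ge⟩, h.2⟩
  · rintro ⟨⟨h, hq⟩, hN⟩
    exact ⟨lt_min h hN, fun q hqx => min_le_of_left_le (hq q hqx)⟩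

/-- A poset filter in `Hom(P,ℕ)` is stable under truncation at some fixed level. -/
lemma exists_forall_truncate_mem {P : Type*} [PartialOrder P] [Finite P]
    (F : Set (P →o ℕ)) (hF : ∀ φ ∈ F, ∀ ψ : P →o ℕ, φ ≤ ψ → ψ ∈ F) :
    ∃ N : ℕ, ∀ φ ∈ F, truncate φ N ∈ F := by
  by_contra! h
  choose φ hφ hφN using h
  have hpwo : (Set.univ : Set (P → ℕ)).IsPWO := Set.isPWO_of_wellQuasiOrderedLE _
  obtain ⟨g, hg⟩ := hpwo.exists_monotone_subseq (f := fun n => ⇑(φ n)) fun _ => Set.mem_univ _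
  obtain ⟨B, hB⟩ := (Set.finite_range (φ (g 0))).bddAbove
  refine hφN (g B) (hF _ (hφ (g 0)) _ fun p => le_min (hg (Nat.zero_le B) p) ?_)
  exact (hB ⟨p, rfl⟩).trans (g.strictMono.id_le B)

/-- For a poset filter `F ⊆ Hom(P,ℕ)`, the collection of ascents `Λφ`, `φ ∈ F`, has
only finitely many inclusion-minimal members. -/
theorem finitely_many_inclusion_minimal_ascents {P : Type*} [PartialOrder P] [Fintype P]
    (F : Set (P →o ℕ)) (hF : ∀ φ ∈ F, ∀ ψ : P →o ℕ, φ ≤ ψ → ψ ∈ F) :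
    {A : Set (P × ℕ) | ∃ φ ∈ F, A = ascent φ ∧
      ∀ ψ ∈ F, ascent ψ ⊆ A → ascent ψ = A}.Finite := by
  obtain ⟨N, hN⟩ := exists_forall_truncate_mem F hF
  refine ((Set.finite_univ (α := P)).prod (Set.finite_Iio N)).finite_subsets.subset ?_
  rintro _ ⟨φ, hφ, rfl, hmin⟩
  rw [Set.mem_ofPred_eq, ← hmin _ (hN φ hφ) fun x hx => ((mem_ascent_truncate φ N x).1 hx).1]
  exact fun x hx => ⟨trivial, ((mem_ascent_truncate φ N x).1 hx).2⟩
end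

section
/- Let J ⊆ Hom(P,ℕ) be a poset ideal. Then the set of minimal markers of J is finite. -/
open MvPolynomial
open scoped Classical

/-- Along an ultrafilter, a natural-valued function that is eventually bounded is eventually
constant. -/
lemma Ultrafilter.exists_eventually_eq_of_eventually_le {X : Type*} (f : Ultrafilter X)
    {g : X → ℕ} {n : ℕ} (h : ∀ᶠ x in f, g x ≤ n) : ∃ c, ∀ᶠ x in f, g x = c := by
  have h' : (⋃ c ∈ Set.Iic n, {x | g x = c}) ∈ f := by
    filter_upwards [h] with x hx
    simpa using hx
  obtain ⟨c, -, hc⟩ := (Ultrafilter.finite_biUnion_mem_iff (Set.finite_Iic n)).1 h'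
  exact ⟨c, hc⟩

/-- An isotone map on a poset ideal that dominates `φ` there extends to an isotone map on the
whole poset that dominates `φ` everywhere. -/
lemma exists_orderHom_extension_ge {P : Type*} [PartialOrder P] [Finite P] {I : Set P}
    (hI : IsPosetIdeal I) {α : I → ℕ} (hα : Monotone α) (φ : P →o ℕ)
    (hφ : ∀ p : I, φ p ≤ α p) : ∃ ψ : P →o ℕ, (∀ p : I, ψ p = α p) ∧ φ ≤ ψ := by
  obtain ⟨M, hM⟩ := (Set.finite_range φ).bddAbove
  obtain ⟨N, hN⟩ := (Set.finite_range α).bddAbove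
  let ψ : P → ℕ := fun p => if h : p ∈ I then α ⟨p, h⟩ else max M N
  refine ⟨⟨ψ, ?_⟩, fun p => dif_pos p.2, fun p => ?_⟩
  · intro p q hpq
    by_cases hq : q ∈ I
    · have hp := hI q hq p hpq
      simpa [ψ, hp, hq] using hα (show (⟨p, hp⟩ : I) ≤ ⟨q, hq⟩ from hpq)
    · by_cases hp : p ∈ I
      · simpa [ψ, hp, hq] using Or.inr (hN ⟨⟨p, hp⟩, rfl⟩)
      · simp [ψ, hp, hq]
  · change φ p ≤ ψ p
    by_cases hp : p ∈ I
    · simpa [ψ, hp] using hφ ⟨p, hp⟩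
    · simpa [ψ, hp] using Or.inl (hM ⟨p, rfl⟩)

/-- A poset ideal `J ⊆ Hom(P,ℕ)` has finitely many minimal markers with a given domain. -/
lemma finite_minimalMarkers_on {P : Type*} [PartialOrder P] [Finite P] {J : Set (P →o ℕ)}
    (hJ : IsPosetIdeal J) (I : Set P) : {α : I → ℕ | IsMinimalMarker J I α}.Finite := by
  by_contra hinf
  have := Filter.cofinite_inf_principal_neBot_iff.2 hinf
  set f := Ultrafilter.of (Filter.cofinite ⊓ Filter.principal {α | IsMinimalMarker J I α})
  have hf : (f : Filter (I → ℕ)) ≤ _ := Ultrafilter.of_le _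
  have hmin : ∀ᶠ α : I → ℕ in f, IsMinimalMarker J I α :=
    hf (Filter.mem_inf_of_right (Filter.mem_principal_self _))
  let C : Set I := {p | ∃ c, ∀ᶠ α : I → ℕ in f, α p = c}
  let B : Set P := Subtype.val '' C
  choose! β hβ using fun (p : I) (hp : p ∈ C) => hp
  have hconst : ∀ᶠ α : I → ℕ in f, ∀ p ∈ C, α p = β p :=
    Filter.eventually_all.2 fun p => Filter.eventually_imp_distrib_left.2 (hβ p)
  have hBI : B ⊆ I := Subtype.coe_image_subset I C
  obtain ⟨α, hα, hαβ⟩ := (hmin.and hconst).exists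
  refine hα.2 B hBI ?_ ⟨?_, fun p q hpq => hα.1.2.1 hpq, ?_⟩
  · intro hB
    have hC (p : I) : p ∈ C := by
      obtain ⟨q, hq, hqp⟩ : (p : P) ∈ B := hB.ge p.2
      exact Subtype.ext hqp ▸ hq
    have hne : ∀ᶠ γ : I → ℕ in f, γ ≠ β :=
      hf (Filter.mem_inf_of_left (Set.finite_singleton β).compl_mem_cofinite)
    obtain ⟨γ, hγ, hγβ⟩ := (hne.and hconst).exists
    exact hγ (funext fun p => hγβ p (hC p))
  · rintro _ ⟨p, hp, rfl⟩ q hqp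
    refine ⟨⟨q, hα.1.1 p p.2 q hqp⟩, ?_, rfl⟩
    refine f.exists_eventually_eq_of_eventually_le (n := β p) ?_
    filter_upwards [hmin, hβ p hp] with γ hγ hγp
    exact hγp ▸ hγ.1.2.1 hqp
  · intro φ hφ
    have hlarge : ∀ᶠ γ : I → ℕ in f, ∀ p ∉ C, φ p ≤ γ p := by
      refine Filter.eventually_all.2 fun p => Filter.eventually_imp_distrib_left.2 fun hp => ?_
      by_contra hlt
      refine hp (f.exists_eventually_eq_of_eventually_le (n := φ p) ?_)
      filter_upwards [Ultrafilter.eventually_not.2 hlt] with γ hγ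
      exact (not_le.1 hγ).le
    obtain ⟨γ, hγ, hγβ, hγφ⟩ := (hmin.and (hconst.and hlarge)).exists
    obtain ⟨ψ, hψ, hφψ⟩ := exists_orderHom_extension_ge hγ.1.1 hγ.1.2.1 φ fun p => by
      by_cases hp : p ∈ C
      · rw [hφ ⟨p, p, hp, rfl⟩, hγβ p hp, ← hαβ p hp]
      · exact hγφ p hp
    exact hJ ψ (hγ.1.2.2 ψ hψ) φ hφψ

/-- For a poset ideal `J ⊆ Hom(P,ℕ)`, the set of minimal markers of `J` is finite. -/
theorem finitely_many_minimal_markers {P : Type*} [PartialOrder P] [Fintype P]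
    (J : Set (P →o ℕ)) (hJ : IsPosetIdeal J) :
    {m : Σ I : Set P, (I → ℕ) | IsMinimalMarker J m.1 m.2}.Finite := by
  refine (Set.finite_iUnion fun I : Set P =>
    (finite_minimalMarkers_on hJ I).image (Sigma.mk I)).subset ?_
  rintro ⟨I, α⟩ h
  exact Set.mem_iUnion.2 ⟨I, α, h, rfl⟩
end

section
/- Let J ⊆ Hom(P,ℕ) be a poset ideal with complement filter J^c. If φ ∈ J and ψ ∈ J^c, then the graph Γφ and the ascent Λψ have nonempty intersection. -/
open MvPolynomial
open scoped Classical

/-- If `J ⊆ Hom(P,ℕ)` is a poset ideal, `φ ∈ J` and `ψ ∈ J^c`, then `Γφ ∩ Λψ ≠ ∅`. -/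
theorem graph_inter_ascent_nonempty {P : Type*} [PartialOrder P] [Fintype P]
    (J : Set (P →o ℕ)) (hJ : IsPosetIdeal J) (φ ψ : P →o ℕ)
    (hφ : φ ∈ J) (hψ : ψ ∉ J) :
    (graphOf φ ∩ ascent ψ).Nonempty := by
  obtain ⟨p₀, hp₀⟩ : ∃ p, φ p < ψ p := by
    by_contra! h
    exact hψ (hJ φ hφ ψ h)
  obtain ⟨p, hp, hmin⟩ := WellFounded.has_min (wellFounded_lt (α := P))
    {p | φ p < ψ p} ⟨p₀, hp₀⟩
  exact ⟨(p, φ p), rfl, hp, fun q hq =>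
    (not_lt.mp fun h => hmin q h hq).trans (φ.monotone hq.le)⟩
end

section
/- Let S ⊆ P×ℕ be a subset which is disjoint from Γφ for some φ ∈ Hom(P,ℕ). If φ is minimal with respect to the pointwise partial order on Hom(P,ℕ) among isotone maps whose graph is disjoint from S, then Λφ ⊆ S. -/
open MvPolynomial
open scoped Classical

/-- Lowering the value of `φ` at `p` to `i` keeps it isotone when `(p, i)` lies in the ascent. -/
lemma monotone_update_of_mem_ascent {P : Type*} [PartialOrder P] {φ : P →o ℕ} {p : P} {i : ℕ}
    (h : (p, i) ∈ ascent φ) : Monotone (Function.update φ p i) := by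
  intro a b hab
  rcases eq_or_ne a p with rfl | ha <;> rcases eq_or_ne b a with rfl | hba
  · rfl
  · simpa [hba] using h.1.le.trans (φ.monotone hab)
  · rfl
  · rcases eq_or_ne b p with rfl | hb
    · simpa [ha] using h.2 a (lt_of_le_of_ne hab ha)
    · simpa [ha, hb] using φ.monotone hab

/-- If `S ⊆ P×ℕ` is disjoint from the graph of some isotone map, and `φ` is minimal
(for the pointwise order) among isotone maps whose graph is disjoint from `S`,
then `Λφ ⊆ S`. -/
theorem ascent_subset_of_minimal_disjoint_graph {P : Type*} [PartialOrder P] [Fintype P]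
    (S : Set (P × ℕ)) (φ : P →o ℕ) (hdis : Disjoint S (graphOf φ))
    (hmin : ∀ ψ : P →o ℕ, Disjoint S (graphOf ψ) → ψ ≤ φ → ψ = φ) :
    ascent φ ⊆ S := by
  rintro ⟨p, i⟩ h
  by_contra hS
  let ψ : P →o ℕ := ⟨Function.update φ p i, monotone_update_of_mem_ascent h⟩
  have hψS : Disjoint S (graphOf ψ) := by
    rw [Set.disjoint_left] at hdis ⊢
    rintro ⟨q, j⟩ hq (hj : Function.update φ p i q = j)
    rcases eq_or_ne q p with rfl | hqp
    · rw [Function.update_self] at hj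
      exact hS (hj ▸ hq)
    · rw [Function.update_of_ne hqp] at hj
      exact hdis hq hj
  have hψφ : ψ ≤ φ := update_le_self_iff.2 h.1.le
  have hp : i = φ p := by
    simpa [ψ] using DFunLike.congr_fun (hmin ψ hψS hψφ) p
  exact h.1.ne hp
end

section
/- Let J ⊆ Hom(P,ℕ) be a poset ideal. The letterplace ideal L(J,P) and the co-letterplace ideal L(P,J) are Alexander dual squarefree monomial ideals: for every finite subset T ⊆ P×ℕ, the squarefree monomial m_T lies in L(J,P) if and only if m_T has a nontrivial common divisor with every monomial of L(P,J) (equivalently, T intersects Γα for every marker α of J); and symmetrically, m_T lies in L(P,J) if and only if T intersects Λψ for every ψ in the complement filter J^c. -/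
open MvPolynomial
open scoped Classical

/-- The letterplace ideal `L(J,P) ⊆ k[x_{P×ℕ}]`: generated by the squarefree monomials
`m_{Λψ}` for `ψ` in the complement filter `J^c`. -/
noncomputable def letterplaceIdeal (k : Type*) [Field k] {P : Type*} [PartialOrder P]
    [Fintype P] (J : Set (P →o ℕ)) : Ideal (MvPolynomial (P × ℕ) k) :=
  Ideal.span {f | ∃ ψ : P →o ℕ, ψ ∉ J ∧ f = ∏ t ∈ (ascent_finite ψ).toFinset, X t}

/-- The co-letterplace ideal `L(P,J) ⊆ k[x_{P×ℕ}]`: generated by the squarefree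
monomials `m_{Γα}` for markers `α` of `J`. -/
noncomputable def coLetterplaceIdeal (k : Type*) [Field k] {P : Type*} [PartialOrder P]
    [Fintype P] (J : Set (P →o ℕ)) : Ideal (MvPolynomial (P × ℕ) k) :=
  Ideal.span {f | ∃ (I : Set P) (α : I → ℕ), IsMarker J I α ∧
    f = ∏ t ∈ (Set.finite_range fun p : I => ((p : P), α p)).toFinset, X t}

theorem prod_X_mem_span_prod_X_iff {σ R : Type*} [CommSemiring R] [Nontrivial R]
    (F : Set (Finset σ)) (T : Finset σ) :
    (∏ t ∈ T, (X t : MvPolynomial σ R)) ∈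
      Ideal.span ((fun s : Finset σ => ∏ t ∈ s, (X t : MvPolynomial σ R)) '' F) ↔
      ∃ s ∈ F, s ⊆ T := by
  constructor
  · intro h
    have key : ∀ s : Finset σ, ∏ t ∈ s, (X t : MvPolynomial σ R) =
        monomial (∑ t ∈ s, Finsupp.single t 1) 1 := fun s => by
      rw [monomial_sum_one]
      rfl
    have himage : (fun s : Finset σ => ∏ t ∈ s, (X t : MvPolynomial σ R)) '' F =
        (fun e => monomial e (1 : R)) '' ((fun s => ∑ t ∈ s, Finsupp.single t 1) '' F) := by
      rw [Set.image_image]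
      exact Set.image_congr fun s _ => key s
    rw [himage, key, mem_ideal_span_monomial_image] at h
    obtain ⟨_, ⟨s, hs, rfl⟩, hle⟩ := h (∑ t ∈ T, Finsupp.single t 1) (by simp [mem_support_iff])
    refine ⟨s, hs, fun t ht => ?_⟩
    have := hle t
    by_contra hT
    simp [Finsupp.finsetSum_apply, Finsupp.single_apply, ht, hT] at this
  · rintro ⟨s, hs, hsT⟩
    exact Ideal.mem_of_dvd _ (Finset.prod_dvd_prod_of_subset _ _ _ hsT)
      (Ideal.subset_span ⟨s, hs, rfl⟩)

theorem prod_X_mem_letterplaceIdeal_iff (k : Type*) [Field k] {P : Type*} [PartialOrder P]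
    [Fintype P] (J : Set (P →o ℕ)) (T : Finset (P × ℕ)) :
    (∏ t ∈ T, (X t : MvPolynomial (P × ℕ) k)) ∈ letterplaceIdeal k J ↔
      ∃ ψ : P →o ℕ, ψ ∉ J ∧ ascent ψ ⊆ T := by
  have h := prod_X_mem_span_prod_X_iff (R := k)
    {s | ∃ ψ : P →o ℕ, ψ ∉ J ∧ s = (ascent_finite ψ).toFinset} T
  convert h using 1
  · rw [letterplaceIdeal]
    congr! 2
    ext f
    constructor
    · rintro ⟨ψ, hψ, rfl⟩
      exact ⟨_, ⟨ψ, hψ, rfl⟩, rfl⟩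
    · rintro ⟨_, ⟨ψ, hψ, rfl⟩, rfl⟩
      exact ⟨ψ, hψ, rfl⟩
  · constructor
    · rintro ⟨ψ, hψ, hT⟩
      exact ⟨_, ⟨ψ, hψ, rfl⟩, Set.Finite.toFinset_subset.2 hT⟩
    · rintro ⟨_, ⟨ψ, hψ, rfl⟩, hT⟩
      exact ⟨ψ, hψ, Set.Finite.toFinset_subset.1 hT⟩

theorem prod_X_mem_coLetterplaceIdeal_iff (k : Type*) [Field k] {P : Type*} [PartialOrder P]
    [Fintype P] (J : Set (P →o ℕ)) (T : Finset (P × ℕ)) :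
    (∏ t ∈ T, (X t : MvPolynomial (P × ℕ) k)) ∈ coLetterplaceIdeal k J ↔
      ∃ (I : Set P) (α : I → ℕ), IsMarker J I α ∧ markerGraph I α ⊆ T := by
  have h := prod_X_mem_span_prod_X_iff (R := k)
    {s | ∃ (I : Set P) (α : I → ℕ), IsMarker J I α ∧
      s = (Set.finite_range fun p : I => ((p : P), α p)).toFinset} T
  convert h using 1
  · rw [coLetterplaceIdeal]
    congr! 2
    ext f
    constructor
    · rintro ⟨I, α, hα, rfl⟩
      exact ⟨_, ⟨I, α, hα, rfl⟩, rfl⟩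
    · rintro ⟨_, ⟨I, α, hα, rfl⟩, rfl⟩
      exact ⟨I, α, hα, rfl⟩
  · constructor
    · rintro ⟨I, α, hα, hT⟩
      exact ⟨_, ⟨I, α, hα, rfl⟩, Set.Finite.toFinset_subset.2 hT⟩
    · rintro ⟨_, ⟨I, α, hα, rfl⟩, hT⟩
      exact ⟨I, α, hα, Set.Finite.toFinset_subset.1 hT⟩

/-- The graph of every marker of `J` meets the ascent of every isotone map outside `J`. -/
theorem IsMarker.markerGraph_inter_ascent_nonempty {P : Type*} [PartialOrder P] [Finite P]
    {J : Set (P →o ℕ)} (hJ : IsPosetIdeal J) {I : Set P} {α : I → ℕ} (hα : IsMarker J I α)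
    {ψ : P →o ℕ} (hψ : ψ ∉ J) : (markerGraph I α ∩ ascent ψ).Nonempty := by
  by_contra hdisj
  obtain ⟨hI, hmono, hext⟩ := hα
  have hle : ∀ p (hp : p ∈ I), ψ p ≤ α ⟨p, hp⟩ := by
    intro p
    induction p using WellFoundedLT.induction with
    | ind p ih =>
      intro hp
      by_contra! hlt
      exact hdisj ⟨(p, α ⟨p, hp⟩), ⟨⟨p, hp⟩, rfl⟩, hlt, fun q hq =>
        (ih q hq (hI p hp q hq.le)).trans (hmono (Subtype.mk_le_mk.2 hq.le))⟩
  obtain ⟨M, hM⟩ := (Set.finite_range α).bddAbove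
  have hM : ∀ p, α p ≤ M := fun p => hM ⟨p, rfl⟩
  let φ : P →o ℕ :=
    { toFun := fun p => if hp : p ∈ I then α ⟨p, hp⟩ else max (ψ p) M
      monotone' := by
        intro p q hpq
        dsimp only
        by_cases hq : q ∈ I
        · have hp := hI q hq p hpq
          simpa [hp, hq] using hmono (Subtype.mk_le_mk.2 hpq)
        · by_cases hp : p ∈ I
          · simp [hp, hq, hM]
          · simpa only [hp, hq, dite_false] using max_le_max_right M (ψ.monotone hpq) }
  refine hψ (hJ φ (hext φ fun p => dif_pos p.2) ψ fun p => ?_)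
  change ψ p ≤ if hp : p ∈ I then α ⟨p, hp⟩ else max (ψ p) M
  split_ifs with hp
  · exact hle p hp
  · exact le_max_left _ _

theorem exists_greedy_isotone_avoiding {P : Type*} [PartialOrder P] [Finite P]
    (S : Set (P × ℕ)) :
    ∃ β : P → ℕ∞, Monotone β ∧ (∀ p (i : ℕ), β p = i → (p, i) ∉ S) ∧
      ∀ p (i : ℕ), (p, i) ∉ S → (∀ q < p, β q ≤ i) → β p ≤ i := by
  let step (p : P) (β : ∀ q, q < p → ℕ∞) : ℕ∞ :=
    sInf ((↑) '' {i : ℕ | (p, i) ∉ S ∧ ∀ q hq, β q hq ≤ i})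
  let β : P → ℕ∞ := WellFoundedLT.fix step
  have hβ : ∀ p, β p = sInf ((↑) '' {i : ℕ | (p, i) ∉ S ∧ ∀ q < p, β q ≤ i}) :=
    fun p => WellFoundedLT.fix_eq step p
  have hmem : ∀ p (i : ℕ), β p = i → (p, i) ∉ S ∧ ∀ q < p, β q ≤ i := by
    intro p i hi
    rw [hβ] at hi
    have hne : ((↑) '' {i : ℕ | (p, i) ∉ S ∧ ∀ q < p, β q ≤ i} : Set ℕ∞).Nonempty := by
      by_contra hempty
      rw [Set.not_nonempty_iff_eq_empty.1 hempty, sInf_empty] at hi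
      exact ENat.top_ne_natCast i hi
    obtain ⟨j, hj, hji⟩ := csInf_mem hne
    rwa [← Nat.cast_inj (R := ℕ∞).1 (hji.trans hi)]
  refine ⟨β, fun p q hpq => ?_, fun p i hi => (hmem p i hi).1, fun p i hi hq => ?_⟩
  · obtain rfl | hlt := hpq.eq_or_lt
    · rfl
    · cases hi : β q with
      | top => exact le_top
      | coe i => exact (hmem q i hi).2 p hlt
  · rw [hβ]
    exact sInf_le ⟨i, ⟨hi, hq⟩, rfl⟩

/-- Every set of letters contains the ascent of an isotone map outside `J` or is disjoint from the
graph of a marker of `J`. -/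
theorem exists_ascent_subset_or_exists_markerGraph_disjoint {P : Type*} [PartialOrder P] [Finite P]
    {J : Set (P →o ℕ)} (hJ : IsPosetIdeal J) (S : Set (P × ℕ)) :
    (∃ ψ : P →o ℕ, ψ ∉ J ∧ ascent ψ ⊆ S) ∨
      ∃ (I : Set P) (α : I → ℕ), IsMarker J I α ∧ Disjoint (markerGraph I α) S := by
  obtain ⟨β, hmono, hnot, hmin⟩ := exists_greedy_isotone_avoiding S
  refine or_iff_not_imp_left.2 fun hS => ⟨{p | β p ≠ ⊤}, fun p => (β p).toNat,
    ⟨fun p hp q hq => ne_top_of_le_ne_top hp (hmono hq),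
      fun p q hpq => ENat.toNat_le_toNat (hmono hpq) q.2, fun φ hφ => ?_⟩, ?_⟩
  · by_contra hφJ
    obtain ⟨M, hM⟩ := (Set.finite_range φ).bddAbove
    have hM : ∀ p, φ p ≤ M := fun p => hM ⟨p, rfl⟩
    have htop : ∀ p, min (β p) (M : ℕ∞) ≠ ⊤ := fun p =>
      ne_top_of_le_ne_top (ENat.natCast_ne_top M) (min_le_right _ _)
    let ψ : P →o ℕ :=
      { toFun := fun p => (min (β p) (M : ℕ∞)).toNat
        monotone' := fun p q hpq =>
          ENat.toNat_le_toNat (min_le_min_right _ (hmono hpq)) (htop q) }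
    have hψ : ∀ p, (ψ p : ℕ∞) = min (β p) (M : ℕ∞) := fun p => ENat.natCast_toNat (htop p)
    refine hS ⟨ψ, fun hψJ => hφJ (hJ ψ hψJ φ fun p => ?_), ?_⟩
    · rw [← Nat.cast_le (α := ℕ∞)]
      change (φ p : ℕ∞) ≤ (ψ p : ℕ∞)
      rw [hψ]
      refine le_min ?_ (Nat.cast_le.2 (hM p))
      by_cases hp : β p = ⊤
      · exact hp ▸ le_top
      · rw [hφ ⟨p, hp⟩, ENat.natCast_toNat hp]
    · rintro ⟨p, i⟩ ⟨hip, hi⟩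
      by_contra hpi
      have hip : (i : ℕ∞) < min (β p) (M : ℕ∞) := hψ p ▸ Nat.cast_lt.2 hip
      refine (hip.trans_le (min_le_left _ _)).not_ge (hmin p i hpi fun q hq => ?_)
      have hqi : min (β q) (M : ℕ∞) ≤ i := hψ q ▸ Nat.cast_le.2 (hi q hq)
      exact (min_le_iff.1 hqi).resolve_right (hip.trans_le (min_le_right _ _)).not_ge
  · rw [Set.disjoint_left]
    rintro _ ⟨p, rfl⟩
    exact hnot p _ (ENat.natCast_toNat p.2).symm

/-- **Alexander duality of letterplace and co-letterplace ideals.** For a poset ideal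
`J ⊆ Hom(P,ℕ)` and a finite `T ⊆ P×ℕ`: `m_T ∈ L(J,P)` iff `T` meets the graph `Γα` of
every marker `α` of `J`, and `m_T ∈ L(P,J)` iff `T` meets the ascent `Λψ` of every
`ψ` in the complement filter `J^c`. -/
theorem letterplace_coletterplace_alexander_dual (k : Type*) [Field k] {P : Type*}
    [PartialOrder P] [Fintype P] (J : Set (P →o ℕ)) (hJ : IsPosetIdeal J)
    (T : Finset (P × ℕ)) :
    ((∏ t ∈ T, (X t : MvPolynomial (P × ℕ) k)) ∈ letterplaceIdeal k J ↔
      ∀ (I : Set P) (α : I → ℕ), IsMarker J I α →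
        ∃ t ∈ T, (t : P × ℕ) ∈ markerGraph I α) ∧
    ((∏ t ∈ T, (X t : MvPolynomial (P × ℕ) k)) ∈ coLetterplaceIdeal k J ↔
      ∀ ψ : P →o ℕ, ψ ∉ J → ∃ t ∈ T, (t : P × ℕ) ∈ ascent ψ) := by
  rw [prod_X_mem_letterplaceIdeal_iff, prod_X_mem_coLetterplaceIdeal_iff]
  refine ⟨⟨?_, fun h => ?_⟩, ⟨?_, fun h => ?_⟩⟩
  · rintro ⟨ψ, hψ, hT⟩ I α hα
    obtain ⟨t, htα, htψ⟩ := hα.markerGraph_inter_ascent_nonempty hJ hψ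
    exact ⟨t, hT htψ, htα⟩
  · refine (exists_ascent_subset_or_exists_markerGraph_disjoint hJ (T : Set (P × ℕ))).resolve_right
      fun ⟨I, α, hα, hdisj⟩ => ?_
    obtain ⟨t, htT, htα⟩ := h I α hα
    exact Set.disjoint_left.1 hdisj htα htT
  · rintro ⟨I, α, hα, hT⟩ ψ hψ
    obtain ⟨t, htα, htψ⟩ := hα.markerGraph_inter_ascent_nonempty hJ hψ
    exact ⟨t, hT htα, htψ⟩
  · obtain ⟨ψ, hψ, hsub⟩ | ⟨I, α, hα, hdisj⟩ :=
      exists_ascent_subset_or_exists_markerGraph_disjoint hJ (T : Set (P × ℕ))ᶜ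
    · obtain ⟨t, htT, htψ⟩ := h ψ hψ
      exact (hsub htψ htT).elim
    · exact ⟨I, α, hα, Set.disjoint_compl_right_iff_subset.1 hdisj⟩
end

section
/- The map Λ̄ : Hom(P,ℕ) → ℕ^P, sending an isotone map φ to the function p ↦ #{i ∈ ℕ : (p,i) ∈ Λφ}, is a bijection between the isotone maps P → ℕ and ℕ^P (equivalently, the monomials of k[x_P]). -/
open MvPolynomial
open scoped Classical

/-- The maximum of `φ` over the elements strictly below `p`, and `0` if `p` is minimal. -/
noncomputable def supBelow {P : Type*} [PartialOrder P] [Fintype P] (φ : P → ℕ) (p : P) : ℕ :=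
  Finset.univ.sup fun q => if q < p then φ q else 0

lemma supBelow_le_iff {P : Type*} [PartialOrder P] [Fintype P] (φ : P → ℕ) (p : P) (i : ℕ) :
    supBelow φ p ≤ i ↔ ∀ q < p, φ q ≤ i := by
  simp only [supBelow, Finset.sup_le_iff, Finset.mem_univ, true_imp_iff]
  refine forall_congr' fun q => ?_
  by_cases h : q < p <;> simp [h]

lemma lambdaBar_eq_sub {P : Type*} [PartialOrder P] [Fintype P] (φ : P →o ℕ) (p : P) :
    lambdaBar φ p = φ p - supBelow φ p := by
  have h : {i : ℕ | (p, i) ∈ ascent φ} = Finset.Ico (supBelow φ p) (φ p) := by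
    ext i
    simp [ascent, supBelow_le_iff, and_comm]
  rw [lambdaBar, h, Set.ncard_coe_finset, Nat.card_Ico]

lemma supBelow_add_lambdaBar {P : Type*} [PartialOrder P] [Fintype P] (φ : P →o ℕ) (p : P) :
    supBelow φ p + lambdaBar φ p = φ p := by
  have h : supBelow φ p ≤ φ p := (supBelow_le_iff _ _ _).2 fun _ hq => φ.monotone hq.le
  rw [lambdaBar_eq_sub, Nat.add_sub_cancel' h]

lemma exists_eq_supBelow_add {P : Type*} [PartialOrder P] [Fintype P] (f : P → ℕ) :
    ∃ φ : P → ℕ, ∀ p, φ p = supBelow φ p + f p := by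
  have wf : WellFounded ((· < ·) : P → P → Prop) := wellFounded_lt
  refine ⟨wf.fix fun p ih => (Finset.univ.sup fun q => if h : q < p then ih q h else 0) + f p,
    fun p => ?_⟩
  rw [wf.fix_eq]
  simp only [supBelow, dite_eq_ite]

/-- The map `Λ̄ : Hom(P,ℕ) → ℕ^P` is a bijection. -/
theorem lambdaBar_bijective {P : Type*} [PartialOrder P] [Fintype P] :
    Function.Bijective (fun φ : P →o ℕ => lambdaBar φ) := by
  constructor
  · intro φ ψ h
    ext p
    induction p using WellFoundedLT.induction with
    | ind p ih =>
      have hsup : supBelow φ p = supBelow ψ p := by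
        refine Finset.sup_congr rfl fun q _ => ?_
        split_ifs with hq
        · exact ih q hq
        · rfl
      rw [← supBelow_add_lambdaBar φ, ← supBelow_add_lambdaBar ψ, hsup]
      exact congrArg _ (congrFun h p)
  · intro f
    obtain ⟨φ, hφ⟩ := exists_eq_supBelow_add f
    have hmono : Monotone φ := monotone_iff_forall_lt.2 fun q p hq =>
      ((supBelow_le_iff φ p _).1 le_rfl q hq).trans (by rw [hφ p]; exact Nat.le_add_right _ _)
    refine ⟨⟨φ, hmono⟩, funext fun p => ?_⟩
    have h := supBelow_add_lambdaBar ⟨φ, hmono⟩ p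
    exact Nat.add_left_cancel (h.trans (hφ p))
end

section
/- If J is a poset ideal in Hom(P,ℕ), then its image Λ̄(J) = {Λ̄φ : φ ∈ J} is a poset ideal in ℕ^P with respect to the pointwise (componentwise) order on ℕ^P. -/
open MvPolynomial
open scoped Classical

lemma lambdaBar_apply {P : Type*} [PartialOrder P] [Fintype P] (φ : P →o ℕ) (p : P) :
    lambdaBar φ p = φ p - (Finset.univ.filter (· < p)).sup φ := by
  have h : {i : ℕ | (p, i) ∈ ascent φ} =
      ↑(Finset.Ico ((Finset.univ.filter (· < p)).sup φ) (φ p)) := by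
    ext i
    simp [ascent, and_comm]
  rw [lambdaBar, h, Set.ncard_coe_finset, Nat.card_Ico]

/-- For every `g : P → ℕ` there is an isotone map with prescribed increments `g`. -/
lemma exists_orderHom_eq_sup_add {P : Type*} [PartialOrder P] [Fintype P] (g : P → ℕ) :
    ∃ ψ : P →o ℕ, ∀ p, ψ p = (Finset.univ.filter (· < p)).sup ψ + g p := by
  have wf : WellFounded ((· < ·) : P → P → Prop) := wellFounded_lt
  let F : (p : P) → ((q : P) → q < p → ℕ) → ℕ := fun p ih =>
    Finset.univ.sup (fun q => if h : q < p then ih q h else 0) + g p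
  have key : ∀ p, wf.fix F p = (Finset.univ.filter (· < p)).sup (wf.fix F) + g p := by
    intro p
    rw [wf.fix_eq]
    simp [F, Finset.sup_ite]
  refine ⟨⟨wf.fix F, fun p q hpq => ?_⟩, key⟩
  rcases hpq.eq_or_lt with rfl | hlt
  · exact le_rfl
  · rw [key q]
    exact (Finset.le_sup (f := wf.fix F) (by simpa using hlt)).trans (Nat.le_add_right _ _)

/-- If `J` is a poset ideal in `Hom(P,ℕ)`, then `Λ̄(J)` is a poset ideal in `ℕ^P`
with the pointwise order. -/
theorem lambdaBar_image_posetIdeal {P : Type*} [PartialOrder P] [Fintype P]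
    (J : Set (P →o ℕ)) (hJ : IsPosetIdeal J) :
    ∀ f ∈ lambdaBar '' J, ∀ g : P → ℕ, g ≤ f → g ∈ lambdaBar '' J := by
  rintro _ ⟨φ, hφ, rfl⟩ g hg
  obtain ⟨ψ, hψ⟩ := exists_orderHom_eq_sup_add g
  refine ⟨ψ, hJ φ hφ ψ fun p => ?_, funext fun p => ?_⟩
  · induction p using WellFoundedLT.induction with
    | ind p ih =>
      have hsup : (Finset.univ.filter (· < p)).sup ψ ≤ (Finset.univ.filter (· < p)).sup φ :=
        Finset.sup_mono_fun fun q hq => ih q (by simpa using hq)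
      have hle : (Finset.univ.filter (· < p)).sup φ ≤ φ p :=
        Finset.sup_le fun q hq => φ.monotone (by simpa using hq : q < p).le
      have hgp : g p ≤ lambdaBar φ p := hg p
      rw [lambdaBar_apply] at hgp
      change ψ p ≤ φ p
      rw [hψ p]
      omega
  · rw [lambdaBar_apply, hψ p, Nat.add_sub_cancel_left]
end

section
/- Let J ⊆ Hom(P,ℕ) be a poset ideal and let L^p(J,P) ⊆ k[x_P] be the ideal generated by the images of the generators of the letterplace ideal L(J,P) under the substitution x_{p,i} ↦ x_p. Then the set of monomials lying in L^p(J,P) is exactly Λ̄(J^c) = {Λ̄ψ : ψ ∈ J^c}; equivalently, the monomials of k[x_P] not in L^p(J,P) are exactly the Λ̄φ for φ ∈ J. -/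
open MvPolynomial
open scoped Classical

/-- `Λ̄φ` as a finitely supported function (exponent vector in `k[x_P]`). -/
noncomputable def lambdaBarF {P : Type*} [PartialOrder P] [Fintype P] (φ : P →o ℕ) :
    P →₀ ℕ :=
  Finsupp.equivFunOnFinite.symm (lambdaBar φ)

/-- The projected letterplace ideal `L^p(J,P) ⊆ k[x_P]`, generated by the images of
the generators `m_{Λψ}`, `ψ ∈ J^c`, of `L(J,P)` under `x_{p,i} ↦ x_p`; the image of
`m_{Λψ}` is the monomial with exponent vector `Λ̄ψ`. -/
noncomputable def projLetterplaceIdeal (k : Type*) [Field k] {P : Type*} [PartialOrder P]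
    [Fintype P] (J : Set (P →o ℕ)) : Ideal (MvPolynomial P k) :=
  Ideal.span {f | ∃ ψ : P →o ℕ, ψ ∉ J ∧ f = monomial (lambdaBarF ψ) 1}

/-- The ascent of `φ` has `φ p - max_{q < p} φ q` elements over `p`. -/
lemma sup_add_lambdaBar {P : Type*} [PartialOrder P] [Fintype P] (φ : P →o ℕ) (p : P) :
    (Finset.univ.filter (· < p)).sup φ + lambdaBar φ p = φ p := by
  have hset : {i : ℕ | (p, i) ∈ ascent φ} =
      ↑(Finset.Ico ((Finset.univ.filter (· < p)).sup φ) (φ p)) := by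
    ext i
    simp [ascent, and_comm]
  have hle : (Finset.univ.filter (· < p)).sup φ ≤ φ p :=
    Finset.sup_le fun q hq => φ.monotone (Finset.mem_filter.1 hq).2.le
  rw [lambdaBar, hset, Set.ncard_coe_finset, Nat.card_Ico]
  omega

/-- The map `Λ̄` reflects the pointwise order. -/
lemma le_of_lambdaBar_le {P : Type*} [PartialOrder P] [Fintype P] {φ ψ : P →o ℕ}
    (h : lambdaBar φ ≤ lambdaBar ψ) : φ ≤ ψ := by
  intro p
  induction p using WellFoundedLT.induction with
  | ind p ih =>
    rw [← sup_add_lambdaBar φ p, ← sup_add_lambdaBar ψ p]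
    exact add_le_add (Finset.sup_mono_fun fun q hq => ih q (Finset.mem_filter.1 hq).2) (h p)

/-- Every multiplicity function is `Λ̄φ` for some isotone map `φ`. -/
lemma lambdaBar_surjective {P : Type*} [PartialOrder P] [Fintype P] :
    Function.Surjective (lambdaBar : (P →o ℕ) → P → ℕ) := by
  intro d
  let F : (p : P) → ((q : P) → q < p → ℕ) → ℕ := fun p f =>
    (Finset.univ.filter (· < p)).attach.sup (fun q => f q (Finset.mem_filter.1 q.2).2) + d p
  let f : P → ℕ := (wellFounded_lt (α := P)).fix F
  have hf (p : P) : f p = (Finset.univ.filter (· < p)).sup f + d p := by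
    rw [← Finset.sup_attach]
    exact (wellFounded_lt (α := P)).fix_eq F p
  have hmono : Monotone f := monotone_iff_forall_lt.2 fun q p hqp => by
    rw [hf p]
    exact le_add_right (Finset.le_sup (f := f) (by simpa using hqp))
  refine ⟨⟨f, hmono⟩, funext fun p => ?_⟩
  exact Nat.add_left_cancel ((sup_add_lambdaBar ⟨f, hmono⟩ p).trans (hf p))

/-- The monomials lying in `L^p(J,P)` are exactly the `Λ̄ψ` for `ψ ∈ J^c`; equivalently,
the monomials of `k[x_P]` not in `L^p(J,P)` are exactly the `Λ̄φ` for `φ ∈ J`. -/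
theorem monomials_of_projLetterplace (k : Type*) [Field k] {P : Type*} [PartialOrder P]
    [Fintype P] (J : Set (P →o ℕ)) (hJ : IsPosetIdeal J) :
    ∀ d : P →₀ ℕ, (monomial d (1 : k)) ∈ projLetterplaceIdeal k J ↔
      ∃ ψ : P →o ℕ, ψ ∉ J ∧ d = lambdaBarF ψ := by
  intro d
  refine ⟨fun hd => ?_, fun ⟨ψ, hψ, hd⟩ => Ideal.subset_span ⟨ψ, hψ, hd ▸ rfl⟩⟩
  have hspan : {f : MvPolynomial P k | ∃ ψ : P →o ℕ, ψ ∉ J ∧ f = monomial (lambdaBarF ψ) 1} =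
      (fun s => monomial s 1) '' (lambdaBarF '' Jᶜ) := by
    ext f
    simp [eq_comm]
  rw [projLetterplaceIdeal, hspan, mem_ideal_span_monomial_image] at hd
  obtain ⟨_, ⟨ψ, hψ, rfl⟩, hle⟩ := hd d (by simp [mem_support_iff])
  obtain ⟨φ, hφ⟩ := lambdaBar_surjective (d : P → ℕ)
  refine ⟨φ, fun hφJ => hψ (hJ φ hφJ ψ (le_of_lambdaBar_le ?_)), ?_⟩
  · rw [hφ]
    exact fun p => hle p
  · ext p
    exact (congrFun hφ p).symm
end

section
/- Let φ ∈ Hom(P,ℕ) and let m = Λ̄φ be the corresponding monomial of k[x_P]. Then for every b ∈ P, the maximal length of a b-chain in m equals φ(b). -/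
open MvPolynomial
open scoped Classical

/-- A `b`-chain of length `r` in a monomial `m` (given by its exponent function
`m : P → ℕ`): a multichain `c 0 ≤ ⋯ ≤ c (r-1)` in `P` with all members `≤ b`, such
that `∏ x_{c i}` divides `m`. -/
def IsBChain {P : Type*} [PartialOrder P] (m : P → ℕ) (b : P) (r : ℕ)
    (c : Fin r → P) : Prop :=
  Monotone c ∧ (∀ i, c i ≤ b) ∧ ∀ p : P, {i | c i = p}.ncard ≤ m p

lemma lambdaBar_eq_card {P : Type*} [PartialOrder P] (φ : P →o ℕ) {p : P} {n : ℕ}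
    (h : φ p ≤ n) :
    lambdaBar φ p = ((Finset.range n).filter fun i => (p, i) ∈ ascent φ).card := by
  rw [lambdaBar, ← Set.ncard_coe_finset]
  congr 1
  ext i
  simp only [Set.mem_ofPred_eq, Finset.coe_filter, Finset.mem_range]
  exact ⟨fun hi => ⟨hi.1.trans_le h, hi⟩, fun hi => hi.2⟩

/-- The level `i < φ b` of the ascent can be hit below `b` by elements increasing with `i`. -/
lemma exists_monotone_mem_ascent {P : Type*} [PartialOrder P] [Finite P]
    (φ : P →o ℕ) (b : P) :
    ∃ c : ℕ → P, Monotone c ∧ (∀ i, c i ≤ b) ∧ ∀ i < φ b, (c i, i) ∈ ascent φ := by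
  induction b using WellFoundedLT.induction with
  | ind b ih =>
    by_cases hne : (Set.Iio b).Nonempty
    · obtain ⟨q, hq, hmax⟩ := (Set.Iio b).exists_max_image φ (Set.toFinite _) hne
      obtain ⟨c, hc, hcq, hca⟩ := ih q hq
      have hle : ∀ i, c i ≤ b := fun i => (hcq i).trans (le_of_lt hq)
      refine ⟨fun i => if i < φ q then c i else b, fun i j hij => ?_, fun i => ?_,
        fun i hi => ?_⟩
      · dsimp only
        split_ifs with h₁ h₂ h₂
        · exact hc hij
        · exact hle i
        · omega
        · exact le_rfl
      · dsimp only
        split_ifs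
        exacts [hle i, le_rfl]
      · dsimp only
        split_ifs with h
        · exact hca i h
        · exact ⟨hi, fun q' hq' => (hmax q' hq').trans (not_lt.mp h)⟩
    · exact ⟨fun _ => b, monotone_const, fun _ => le_rfl,
        fun i hi => ⟨hi, fun q hq => (hne ⟨q, hq⟩).elim⟩⟩

lemma exists_isBChain_lambdaBar {P : Type*} [PartialOrder P] [Finite P]
    (φ : P →o ℕ) (b : P) :
    ∃ c : Fin (φ b) → P, IsBChain (lambdaBar φ) b (φ b) c := by
  obtain ⟨c, hc, hcb, hca⟩ := exists_monotone_mem_ascent φ b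
  refine ⟨fun i => c i, fun i j hij => hc hij, fun i => hcb i, fun p => ?_⟩
  refine Set.ncard_le_ncard_of_injOn Fin.val ?_ Fin.val_injective.injOn
    ((Set.finite_Iio (φ p)).subset fun i hi => hi.1)
  rintro i rfl
  exact hca i i.2

lemma IsBChain.length_le {P : Type*} [PartialOrder P] {φ : P →o ℕ} {b : P} {r : ℕ}
    {c : Fin r → P} (h : IsBChain (lambdaBar φ) b r c) : r ≤ φ b := by
  obtain ⟨hmono, hle, hcard⟩ := h
  let A : P → Finset ℕ := fun p => (Finset.range (φ b)).filter fun i => (p, i) ∈ ascent φ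
  have hdisj : ∀ i j, c i < c j → Disjoint (A (c i)) (A (c j)) := by
    intro i j hij
    rw [Finset.disjoint_left]
    intro k hi hj
    exact absurd ((Finset.mem_filter.mp hj).2.2 _ hij)
      (not_le.mpr (Finset.mem_filter.mp hi).2.1)
  have hpair : Set.PairwiseDisjoint (Finset.univ.image c : Set P) A := by
    intro p hp q hq hpq
    obtain ⟨i, -, rfl⟩ := Finset.mem_image.mp (Finset.mem_coe.mp hp)
    obtain ⟨j, -, rfl⟩ := Finset.mem_image.mp (Finset.mem_coe.mp hq)
    rcases le_total i j with hij | hij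
    · exact hdisj i j (lt_of_le_of_ne (hmono hij) hpq)
    · exact (hdisj j i (lt_of_le_of_ne (hmono hij) hpq.symm)).symm
  calc r = (Finset.univ : Finset (Fin r)).card := by simp
    _ = ∑ p ∈ Finset.univ.image c, (Finset.univ.filter fun i => c i = p).card :=
      Finset.card_eq_sum_card_image c _
    _ ≤ ∑ p ∈ Finset.univ.image c, (A p).card := by
      refine Finset.sum_le_sum fun p hp => ?_
      obtain ⟨i, -, rfl⟩ := Finset.mem_image.mp hp
      rw [← lambdaBar_eq_card φ (φ.monotone (hle i)), ← Set.ncard_coe_finset]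
      simpa using hcard (c i)
    _ = ((Finset.univ.image c).biUnion A).card := (Finset.card_biUnion hpair).symm
    _ ≤ (Finset.range (φ b)).card :=
      Finset.card_le_card (Finset.biUnion_subset.mpr fun p _ => Finset.filter_subset _ _)
    _ = φ b := Finset.card_range _

/-- For `φ ∈ Hom(P,ℕ)` and the monomial `m = Λ̄φ` of `k[x_P]`, the maximal length
of a `b`-chain in `m` equals `φ(b)`, for every `b ∈ P`. -/
theorem longest_bchain_in_lambdaBar {P : Type*} [PartialOrder P] [Fintype P]
    (φ : P →o ℕ) (b : P) :
    (∃ c : Fin (φ b) → P, IsBChain (lambdaBar φ) b (φ b) c) ∧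
    (∀ (r : ℕ) (c : Fin r → P), IsBChain (lambdaBar φ) b r c → r ≤ φ b) := by
  exact ⟨exists_isBChain_lambdaBar φ b, fun _ _ h => h.length_le⟩
end

section
/- Let 𝔪 = (x_p : p ∈ P) be the graded maximal ideal of k[x_P] and let d ≥ 2. Then the power 𝔪^d is P-stable if and only if P is a disjoint union of posets whose Hasse diagrams are rooted trees with the roots on top; equivalently, if and only if every element of P is covered by at most one element. -/
open MvPolynomial
open scoped Classical

/-- A longest `b`-chain in `m`: a `b`-chain in `m` such that no `b`-chain in `m`
is longer. -/
def IsLongestBChain {P : Type*} [PartialOrder P] (m : P → ℕ) (b : P) (r : ℕ)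
    (c : Fin r → P) : Prop :=
  IsBChain m b r c ∧ ∀ (r' : ℕ) (c' : Fin r' → P), IsBChain m b r' c' → r' ≤ r

/-- `a` may be inserted into the multichain `c` to make it a larger multichain
(`a` may coincide with some member of `c`). -/
def InsertedThrough {P : Type*} [PartialOrder P] (a : P) {r : ℕ} (c : Fin r → P) : Prop :=
  ∃ (c' : Fin (r + 1) → P) (j : Fin (r + 1)), Monotone c' ∧ c' j = a ∧
    c = c' ∘ j.succAbove

/-- A monomial ideal: an ideal generated by the monomials belonging to it. -/
def IsMonomialIdeal (k : Type*) [Field k] {σ : Type*} (I : Ideal (MvPolynomial σ k)) :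
    Prop :=
  I = Ideal.span {f | ∃ d : σ →₀ ℕ, f = monomial d (1 : k) ∧ f ∈ I}

/-- A monomial ideal `I ⊆ k[x_P]` is `P`-stable if: whenever `m = n·∏_{b∈B} x_b ∈ I`
with `B ⊆ P` an antichain, and `a ∈ P` is such that for every `b ∈ B` some longest
`b`-chain in `m` goes through `a`, then `n·x_a ∈ I`. -/
def PStable (k : Type*) [Field k] {P : Type*} [PartialOrder P] [Fintype P]
    (I : Ideal (MvPolynomial P k)) : Prop :=
  ∀ (n : P →₀ ℕ) (B : Finset P) (a : P),
    IsAntichain (· ≤ ·) (B : Set P) →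
    monomial (n + ∑ b ∈ B, Finsupp.single b 1) (1 : k) ∈ I →
    (∀ b ∈ B, a ≤ b ∧ ∃ (r : ℕ) (c : Fin r → P),
      IsLongestBChain (fun p => (n + ∑ b ∈ B, Finsupp.single b 1 : P →₀ ℕ) p) b r c ∧ InsertedThrough a c) →
    monomial (n + Finsupp.single a 1) (1 : k) ∈ I

/-- A monomial lies in the `d`-th power of the graded maximal ideal iff its degree is at
least `d`. -/
lemma monomial_one_mem_pow_span_range_X_iff {k σ : Type*} [Field k] (d : ℕ) (s : σ →₀ ℕ) :
    monomial s (1 : k) ∈ (Ideal.span (Set.range (X : σ → MvPolynomial σ k))) ^ d ↔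
      d ≤ s.degree := by
  change monomial s (1 : k) ∈ idealOfVars σ k ^ d ↔ _
  simp [monomial_mem_pow_idealOfVars_iff]

/-- If every element is covered by at most one element, then the elements above a fixed one
form a chain. -/
lemma le_total_of_covBy_unique {P : Type*} [PartialOrder P] [Finite P]
    (h : ∀ a b c : P, a ⋖ b → a ⋖ c → b = c) {a b c : P} (hb : a ≤ b) (hc : a ≤ c) :
    b ≤ c ∨ c ≤ b := by
  induction a using WellFoundedGT.induction with
  | ind a ih =>
    rcases hb.eq_or_lt with rfl | hb'
    · exact .inl hc
    rcases hc.eq_or_lt with rfl | hc'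
    · exact .inr hb
    obtain ⟨x, hax, hxb⟩ := exists_covBy_le_of_lt hb'
    obtain ⟨y, hay, hyc⟩ := exists_covBy_le_of_lt hc'
    obtain rfl := h a x y hax hay
    exact ih x hax.lt hxb hyc

/-- A multichain below `b` in a monomial whose only variables dividing it and lying below `b`
are `x_a` and `x_b` has length at most the sum of their exponents. -/
lemma IsBChain.length_le_s14 {P : Type*} [PartialOrder P] {m : P → ℕ} {a b : P} {r : ℕ}
    {c : Fin r → P} (hc : IsBChain m b r c) (hm : ∀ p ≤ b, p ≠ a → p ≠ b → m p = 0) :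
    r ≤ m a + m b := by
  have hcover : (Set.univ : Set (Fin r)) ⊆ {i | c i = a} ∪ {i | c i = b} := by
    intro i _
    by_contra hi
    simp only [Set.mem_union, Set.mem_ofPred_eq, not_or] at hi
    have h0 := hc.2.2 (c i)
    rw [hm _ (hc.2.1 i) hi.1 hi.2, Nat.le_zero, Set.ncard_eq_zero] at h0
    exact Set.eq_empty_iff_forall_notMem.1 h0 i rfl
  calc r = (Set.univ : Set (Fin r)).ncard := by simp [Set.ncard_univ]
    _ ≤ _ := Set.ncard_le_ncard hcover
    _ ≤ _ := Set.ncard_union_le _ _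
    _ ≤ _ := Nat.add_le_add (hc.2.2 a) (hc.2.2 b)

/-- If `x_a ^ e * x_b` is, up to variables not below `b`, the monomial `m`, where `a < b`,
then some longest `b`-chain in `m` goes through `a`. -/
lemma exists_isLongestBChain_insertedThrough {P : Type*} [PartialOrder P] {m : P → ℕ}
    {a b : P} {e : ℕ} (hab : a < b) (ha : m a = e) (hb : m b = 1)
    (hm : ∀ p ≤ b, p ≠ a → p ≠ b → m p = 0) :
    ∃ (r : ℕ) (c : Fin r → P), IsLongestBChain m b r c ∧ InsertedThrough a c := by
  have hmono : ∀ r s : ℕ, Monotone fun i : Fin r => if i.val < s then a else b := by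
    intro r s i j hij
    have : i.val ≤ j.val := hij
    dsimp only
    split_ifs <;> first | exact le_rfl | exact hab.le | omega
  refine ⟨e + 1, fun i => if i.val < e then a else b,
    ⟨⟨hmono _ _, fun i => ?_, fun p => ?_⟩, fun r' c' hc' => ?_⟩,
    fun i => if i.val < e + 1 then a else b, 0, hmono _ _, by simp, ?_⟩
  · dsimp only
    split_ifs
    exacts [hab.le, le_rfl]
  · by_cases hpa : p = a
    · subst hpa
      have hsub : {i : Fin (e + 1) | (if i.val < e then p else b) = p} ⊆
          Set.range (Fin.castSucc : Fin e → Fin (e + 1)) := by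
        intro i hi
        have hlt : i.val < e := by
          by_contra hn
          simp only [Set.mem_ofPred_eq, if_neg hn] at hi
          exact hab.ne' hi
        exact ⟨⟨i, hlt⟩, rfl⟩
      refine (Set.ncard_le_ncard hsub).trans ?_
      rw [ha, ← Set.image_univ]
      exact (Set.ncard_image_le).trans (by simp [Set.ncard_univ])
    · by_cases hpb : p = b
      · subst hpb
        rw [hb]
        refine (Set.ncard_le_ncard (t := {Fin.last e}) fun i hi => ?_).trans
          (Set.ncard_singleton _).le
        have hlt : ¬ i.val < e := by
          intro hn
          simp only [Set.mem_ofPred_eq, if_pos hn] at hi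
          exact hab.ne hi
        exact Fin.ext (by simp; omega)
      · have : {i : Fin (e + 1) | (if i.val < e then a else b) = p} = ∅ := by
          ext i
          simp only [Set.mem_ofPred_eq, Set.mem_empty_iff_false, iff_false]
          split_ifs
          exacts [Ne.symm hpa, Ne.symm hpb]
        simp [this]
  · have := hc'.length_le_s14 hm
    omega
  · funext i
    simp

/-- For `d ≥ 2`, the power `𝔪^d` of the graded maximal ideal of `k[x_P]` is `P`-stable
iff `P` is a disjoint union of rooted trees with roots on top, i.e. iff each element
of `P` is covered by at most one element. -/
theorem maximalIdeal_pow_pStable_iff (k : Type*) [Field k] {P : Type*} [PartialOrder P]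
    [Fintype P] (d : ℕ) (hd : 2 ≤ d) :
    PStable k ((Ideal.span (Set.range (X : P → MvPolynomial P k))) ^ d) ↔
    ∀ a b c : P, a ⋖ b → a ⋖ c → b = c := by
  constructor
  · intro hS a b c hab hac
    by_contra hne
    obtain ⟨e, rfl⟩ := Nat.exists_eq_add_of_le' hd
    have hbc : ¬ b ≤ c := fun h => hac.2 hab.lt (lt_of_le_of_ne h hne)
    have hcb : ¬ c ≤ b := fun h => hab.2 hac.lt (lt_of_le_of_ne h (Ne.symm hne))
    have key := hS (Finsupp.single a e) {b, c} a
    simp only [monomial_one_mem_pow_span_range_X_iff, map_add, Finsupp.degree_single,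
      Finset.sum_pair hne] at key
    have hle : e + 2 ≤ e + 1 := by
      refine key ?_ le_rfl ?_
      · intro x hx y hy hxy
        simp only [Finset.coe_insert, Finset.coe_singleton, Set.mem_insert_iff,
          Set.mem_singleton_iff] at hx hy
        rcases hx with rfl | rfl <;> rcases hy with rfl | rfl <;> first
          | exact absurd rfl hxy
          | assumption
      · intro x hx
        simp only [Finset.mem_insert, Finset.mem_singleton] at hx
        rcases hx with rfl | rfl
        · refine ⟨hab.le, exists_isLongestBChain_insertedThrough (e := e) hab.lt ?_ ?_ ?_⟩
          · simp [hab.lt.ne', hac.lt.ne']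
          · simp [hab.lt.ne, hne]
          · intro p hp hpa hpx
            have : c ≠ p := fun h => hcb (h ▸ hp)
            simp [Ne.symm hpa, Ne.symm hpx, this]
        · refine ⟨hac.le, exists_isLongestBChain_insertedThrough (e := e) hac.lt ?_ ?_ ?_⟩
          · simp [hab.lt.ne', hac.lt.ne']
          · simp [hac.lt.ne, hne]
          · intro p hp hpa hpx
            have : b ≠ p := fun h => hbc (h ▸ hp)
            simp [Ne.symm hpa, Ne.symm hpx, this]
    omega
  · intro h n B a hB hmem hchain
    have hcard : B.card ≤ 1 := by
      refine Finset.card_le_one.2 fun x hx y hy => ?_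
      rcases le_total_of_covBy_unique h (hchain x hx).1 (hchain y hy).1 with hxy | hyx
      · exact hB.eq hx hy hxy
      · exact (hB.eq hy hx hyx).symm
    rw [monomial_one_mem_pow_span_range_X_iff] at hmem ⊢
    simp only [map_add, map_sum, Finsupp.degree_single, Finset.sum_const, smul_eq_mul,
      mul_one] at hmem ⊢
    omega
end

section
/- Let L ⊆ k[x_P] be a P-stable monomial ideal. Then every associated prime ideal of L is of the form 𝔭(I) = (x_p : p ∈ I) for some poset ideal I ⊆ P. -/
open MvPolynomial
open scoped Classical

section MonomialIdeal

variable {k : Type*} [Field k] {σ : Type*}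

lemma IsMonomialIdeal.mem_iff {L : Ideal (MvPolynomial σ k)} (hL : IsMonomialIdeal k L)
    (f : MvPolynomial σ k) :
    f ∈ L ↔ ∀ d ∈ f.support, monomial d (1 : k) ∈ L := by
  constructor
  · intro hf d hd
    have hset : {f | ∃ d : σ →₀ ℕ, f = monomial d (1 : k) ∧ f ∈ L} =
        (fun s => monomial s (1 : k)) '' {s | monomial s (1 : k) ∈ L} := by
      ext g
      constructor
      · rintro ⟨s, rfl, hs⟩
        exact ⟨s, hs, rfl⟩
      · rintro ⟨s, hs, rfl⟩
        exact ⟨s, rfl, hs⟩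
    rw [hL, hset, mem_ideal_span_monomial_image] at hf
    obtain ⟨s, hs, hsd⟩ := hf d hd
    have h : monomial d (1 : k) = monomial (d - s) 1 * monomial s 1 := by
      rw [monomial_mul, tsub_add_cancel_of_le hsd, one_mul]
    rw [h]
    exact L.mul_mem_left _ hs
  · intro h
    rw [f.as_sum]
    refine L.sum_mem fun d hd => ?_
    have h' : monomial d (coeff d f) = C (coeff d f) * monomial d (1 : k) := by
      rw [C_mul_monomial, mul_one]
    rw [h']
    exact L.mul_mem_left _ (h d hd)

lemma monomial_add_mem {L : Ideal (MvPolynomial σ k)} {d : σ →₀ ℕ} (e : σ →₀ ℕ)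
    (h : monomial d (1 : k) ∈ L) : monomial (e + d) (1 : k) ∈ L := by
  have h' : monomial (e + d) (1 : k) = monomial e 1 * monomial d 1 := by
    rw [monomial_mul, one_mul]
  rw [h']
  exact L.mul_mem_left _ h

/-- The exponents of the monomials of `f` that do not lie in `L`. -/
noncomputable def outsideSupport (L : Ideal (MvPolynomial σ k)) (f : MvPolynomial σ k) :
    Finset (σ →₀ ℕ) :=
  {d ∈ f.support | monomial d (1 : k) ∉ L}

lemma mem_outsideSupport {L : Ideal (MvPolynomial σ k)} {f : MvPolynomial σ k}
    {d : σ →₀ ℕ} :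
    d ∈ outsideSupport L f ↔ d ∈ f.support ∧ monomial d (1 : k) ∉ L := by
  simp [outsideSupport]

/-- If `g * f` lies in a monomial ideal not containing `f`, some monomial of `f` outside the
ideal is moved into it by the leading monomial of `g`. -/
lemma IsMonomialIdeal.exists_degree_add_mem {L : Ideal (MvPolynomial σ k)}
    (hL : IsMonomialIdeal k L) (m : MonomialOrder σ) {f g : MvPolynomial σ k} (hg : g ≠ 0)
    (hf : f ∉ L) (hgf : g * f ∈ L) :
    ∃ d ∈ outsideSupport L f, monomial (m.degree g + d) (1 : k) ∈ L := by
  set f' : MvPolynomial σ k := ∑ d ∈ outsideSupport L f, monomial d (coeff d f) with hf'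
  have hcoeff (c : σ →₀ ℕ) : coeff c f' = if c ∈ outsideSupport L f then coeff c f else 0 := by
    simp [hf', coeff_sum, coeff_monomial]
  have hsub : f - f' ∈ L := by
    rw [hL.mem_iff]
    intro d hd
    by_contra hdL
    rw [mem_support_iff, coeff_sub, hcoeff] at hd
    split_ifs at hd with h
    · simp at hd
    · refine h (mem_outsideSupport.2 ⟨?_, hdL⟩)
      simpa using hd
  have hf'0 : f' ≠ 0 := by
    intro h
    rw [h, sub_zero] at hsub
    exact hf hsub
  have hgf' : g * f' ∈ L := by
    have h := L.sub_mem hgf (L.mul_mem_left g hsub)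
    rwa [← mul_sub, sub_sub_cancel] at h
  have hlead : coeff (m.degree f') f' ≠ 0 := m.leadingCoeff_ne_zero_iff.2 hf'0
  refine ⟨m.degree f', ?_, ?_⟩
  · by_contra h
    rw [hcoeff, if_neg h] at hlead
    exact hlead rfl
  · refine (hL.mem_iff _).1 hgf' _ ?_
    rw [mem_support_iff, m.coeff_mul_of_degree_add]
    exact mul_ne_zero (m.leadingCoeff_ne_zero_iff.2 hg) hlead

lemma IsMonomialIdeal.exists_pow_leading_mul_mem {L : Ideal (MvPolynomial σ k)}
    (hL : IsMonomialIdeal k L) (m : MonomialOrder σ) {g : MvPolynomial σ k} (hg : g ≠ 0)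
    (f : MvPolynomial σ k) (hgf : g * f ∈ L) :
    ∃ N : ℕ, monomial (m.degree g) (1 : k) ^ N * f ∈ L := by
  induction hn : (outsideSupport L f).card using Nat.strong_induction_on generalizing f with
  | _ n ih =>
    by_cases hf : f ∈ L
    · exact ⟨0, by simpa using hf⟩
    obtain ⟨d, hd, hdL⟩ := hL.exists_degree_add_mem m hg hf hgf
    have hsub : outsideSupport L (monomial (m.degree g) (1 : k) * f) ⊆
        ((outsideSupport L f).erase d).image (m.degree g + ·) := by
      intro c hc
      obtain ⟨hc, hcL⟩ := mem_outsideSupport.1 hc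
      rw [mem_support_iff, coeff_monomial_mul'] at hc
      split_ifs at hc with hle
      · obtain ⟨c', rfl⟩ := exists_add_of_le hle
        rw [add_tsub_cancel_left, one_mul] at hc
        refine Finset.mem_image.2 ⟨c', Finset.mem_erase.2 ⟨?_, mem_outsideSupport.2
          ⟨mem_support_iff.2 hc, fun h => hcL (monomial_add_mem _ h)⟩⟩, rfl⟩
        rintro rfl
        exact hcL hdL
      · exact absurd rfl hc
    have hlt : (outsideSupport L (monomial (m.degree g) (1 : k) * f)).card < n := by
      calc _ ≤ _ := Finset.card_le_card hsub
        _ ≤ _ := Finset.card_image_le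
        _ < n := hn ▸ Finset.card_erase_lt_of_mem hd
    obtain ⟨N, hN⟩ := ih _ hlt (monomial (m.degree g) (1 : k) * f)
      (by rw [mul_left_comm]; exact L.mul_mem_left _ hgf) rfl
    exact ⟨N + 1, by rwa [pow_succ, mul_assoc]⟩

lemma exists_X_mem_of_monomial_mem {p : Ideal (MvPolynomial σ k)} (hp : p.IsPrime)
    {d : σ →₀ ℕ} (h : monomial d (1 : k) ∈ p) : ∃ i ∈ d.support, X i ∈ p := by
  rw [monomial_eq, C_1, one_mul, Finsupp.prod] at h
  obtain ⟨i, hi, h⟩ := hp.prod_mem_iff.1 h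
  exact ⟨i, hi, hp.mem_of_pow_mem _ h⟩

/-- An associated prime of a monomial ideal is generated by variables. -/
lemma IsMonomialIdeal.associatedPrime_eq_span_X {L : Ideal (MvPolynomial σ k)}
    (hL : IsMonomialIdeal k L) (m : MonomialOrder σ) {p : Ideal (MvPolynomial σ k)}
    (hp : p.IsPrime) {f : MvPolynomial σ k} (hpf : ∀ g, g ∈ p ↔ g * f ∈ L) :
    p = Ideal.span ((fun a => (X a : MvPolynomial σ k)) '' {a | X a ∈ p}) := by
  apply le_antisymm
  · intro g hgp
    induction hn : g.support.card using Nat.strong_induction_on generalizing g with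
    | _ n ih =>
      by_cases hg : g = 0
      · rw [hg]
        exact Ideal.zero_mem _
      obtain ⟨N, hN⟩ := hL.exists_pow_leading_mul_mem m hg f ((hpf g).1 hgp)
      have hlm : monomial (m.degree g) (1 : k) ∈ p :=
        hp.mem_of_pow_mem N ((hpf _).2 hN)
      have hlc : m.leadingTerm g = C (m.leadingCoeff g) * monomial (m.degree g) (1 : k) := by
        rw [C_mul_monomial, mul_one, MonomialOrder.leadingTerm]
      have hltp : m.leadingTerm g ∈ p := hlc ▸ p.mul_mem_left _ hlm
      have hlt : (g - m.leadingTerm g).support.card < n := by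
        rw [← hn]
        apply Finset.card_lt_card
        refine Finset.ssubset_iff_of_subset ?_ |>.2 ⟨m.degree g, ?_, ?_⟩
        · intro c hc
          rw [mem_support_iff, coeff_sub, MonomialOrder.leadingTerm, coeff_monomial] at hc
          rw [mem_support_iff]
          split_ifs at hc with h
          · subst h
            exact absurd (sub_self _) hc
          · rwa [sub_zero] at hc
        · exact mem_support_iff.2 (m.leadingCoeff_ne_zero_iff.2 hg)
        · rw [mem_support_iff, coeff_sub, MonomialOrder.leadingTerm, coeff_monomial, if_pos rfl,
            not_not]
          exact sub_self _
      have hrec := ih _ hlt (p.sub_mem hgp hltp) rfl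
      rw [← sub_add_cancel g (m.leadingTerm g)]
      refine Ideal.add_mem _ hrec ?_
      rw [hlc]
      refine Ideal.mul_mem_left _ _ ?_
      obtain ⟨i, hi, hip⟩ := exists_X_mem_of_monomial_mem hp hlm
      rw [mem_ideal_span_X_image]
      intro c hc
      rw [support_monomial, if_neg one_ne_zero, Finset.mem_singleton] at hc
      subst hc
      exact ⟨i, hip, Finsupp.mem_support_iff.1 hi⟩
  · rw [Ideal.span_le]
    rintro _ ⟨a, ha, rfl⟩
    exact ha

end MonomialIdeal

lemma nonempty_monomialOrder.{u} (σ : Type u) [Finite σ] :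
    Nonempty (MonomialOrder.{u, u} σ) := by
  obtain ⟨n, ⟨e⟩⟩ := Finite.exists_equiv_fin σ
  let _ : LinearOrder σ := LinearOrder.lift' e e.injective
  exact ⟨MonomialOrder.lex⟩

lemma card_eq_sum_ncard_fiber {P : Type*} [Fintype P] {r : ℕ} (c : Fin r → P) :
    r = ∑ p : P, {i | c i = p}.ncard := by
  have h := Finset.card_eq_sum_card_fiberwise (s := (Finset.univ : Finset (Fin r)))
    (t := (Finset.univ : Finset P)) (f := c) (fun _ _ => Finset.mem_coe.2 (Finset.mem_univ _))
  rw [Finset.card_univ, Fintype.card_fin] at h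
  refine h.trans (Finset.sum_congr rfl fun p _ => ?_)
  rw [← Set.ncard_coe_finset]
  simp

section Chains

variable {P : Type*} [PartialOrder P]

lemma insertedThrough_of_mem {r : ℕ} {c : Fin r → P} (hc : Monotone c) (i : Fin r) :
    InsertedThrough (c i) c := by
  refine ⟨c ∘ i.predAbove, i.castSucc, hc.comp (Fin.predAbove_right_monotone i), ?_, ?_⟩
  · simp
  · funext j
    simp only [Function.comp_apply]
    congr 1
    by_cases h : j < i
    · rw [Fin.succAbove_of_castSucc_lt _ _ (by simpa using h),
        Fin.predAbove_castSucc_of_le _ _ h.le]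
    · rw [Fin.succAbove_of_le_castSucc _ _ (by simpa using h),
        Fin.predAbove_succ_of_le _ _ (by simpa using h)]

lemma exists_isLongestBChain [Fintype P] (m : P → ℕ) (b : P) :
    ∃ (r : ℕ) (c : Fin r → P), IsLongestBChain m b r c := by
  have hbdd : ∀ r, (∃ c : Fin r → P, IsBChain m b r c) → r ≤ ∑ p, m p := by
    rintro r ⟨c, hc⟩
    rw [card_eq_sum_ncard_fiber c]
    exact Finset.sum_le_sum fun p _ => hc.2.2 p
  have h0 : ∃ c : Fin 0 → P, IsBChain m b 0 c :=
    ⟨Fin.elim0, fun i => i.elim0, fun i => i.elim0, fun p => by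
      simp [Set.eq_empty_of_isEmpty]⟩
  obtain ⟨c, hc⟩ := Nat.findGreatest_spec
    (P := fun r => ∃ c : Fin r → P, IsBChain m b r c) (Nat.zero_le _) h0
  exact ⟨_, c, hc, fun r' c' hc' => Nat.le_findGreatest (hbdd r' ⟨c', hc'⟩) ⟨c', hc'⟩⟩

/-- If the exponent of `a` exceeds the sum of all the others, every longest `b`-chain with
`a ≤ b` contains `a`. -/
lemma IsLongestBChain.exists_eq [Fintype P] {m : P → ℕ} {a b : P} (hab : a ≤ b)
    (hm : ∑ p ∈ Finset.univ.erase a, m p < m a) {r : ℕ} {c : Fin r → P}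
    (hc : IsLongestBChain m b r c) : ∃ i, c i = a := by
  by_contra! hne
  have hconst : IsBChain m b (m a) (fun _ => a) := by
    refine ⟨monotone_const, fun _ => hab, fun p => ?_⟩
    by_cases h : a = p
    · subst h
      simp [Set.ncard_univ]
    · simp [h]
  have hle := hc.2 _ _ hconst
  have hr : r ≤ ∑ p ∈ Finset.univ.erase a, m p := by
    rw [card_eq_sum_ncard_fiber c, ← Finset.add_sum_erase _ _ (Finset.mem_univ a)]
    have h0 : {i | c i = a}.ncard = 0 := by
      simp [hne]
    rw [h0, zero_add]
    exact Finset.sum_le_sum fun p _ => hc.1.2.2 p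
  omega

end Chains

/-- In a `P`-stable ideal, `x_b` may be replaced by `x_a` for `a ≤ b` after multiplying by a
large power of `x_a`. -/
lemma PStable.monomial_add_single_mem {k : Type*} [Field k] {P : Type*} [PartialOrder P]
    [Fintype P] {L : Ideal (MvPolynomial P k)} (hL : PStable k L) {a b : P} (hab : a ≤ b)
    {d : P →₀ ℕ} (hd : monomial (d + Finsupp.single b 1) (1 : k) ∈ L) {N : ℕ}
    (hN : ∑ p, d p + 1 < N) : monomial (d + Finsupp.single a (N + 1)) (1 : k) ∈ L := by
  rcases eq_or_ne a b with rfl | hne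
  · have h := monomial_add_mem (Finsupp.single a N) hd
    rwa [add_left_comm, ← Finsupp.single_add] at h
  have h := hL (d + Finsupp.single a N) {b} a (by simp) ?_ ?_
  · rwa [add_assoc, ← Finsupp.single_add] at h
  · have h := monomial_add_mem (Finsupp.single a N) hd
    rwa [Finset.sum_singleton, add_right_comm, add_comm]
  · intro b' hb'
    rw [Finset.mem_singleton] at hb'
    subst hb'
    refine ⟨hab, ?_⟩
    obtain ⟨r, c, hc⟩ := exists_isLongestBChain
      (fun p => (d + Finsupp.single a N + ∑ b ∈ {b'}, Finsupp.single b 1 : P →₀ ℕ) p) b'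
    refine ⟨r, c, hc, ?_⟩
    obtain ⟨i, rfl⟩ := hc.exists_eq hab (by
      have hb : b' ∈ Finset.univ.erase a := Finset.mem_erase.2 ⟨hne.symm, Finset.mem_univ _⟩
      have hsum : ∑ p ∈ Finset.univ.erase a, (d + Finsupp.single a N +
          ∑ b ∈ {b'}, Finsupp.single b 1 : P →₀ ℕ) p = ∑ p ∈ Finset.univ.erase a, d p + 1 := by
        rw [Finset.sum_singleton]
        simp only [Finsupp.add_apply, Finset.sum_add_distrib]
        have h1 : ∑ p ∈ Finset.univ.erase a, Finsupp.single a N p = 0 :=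
          Finset.sum_eq_zero fun p hp => Finsupp.single_eq_of_ne (Finset.ne_of_mem_erase hp)
        have h2 : ∑ p ∈ Finset.univ.erase a, Finsupp.single b' 1 p = 1 := by
          rw [Finset.sum_eq_single_of_mem b' hb
            (fun p _ hp => Finsupp.single_eq_of_ne hp), Finsupp.single_eq_same]
        rw [h1, h2, add_zero]
      have hle : ∑ p ∈ Finset.univ.erase a, d p ≤ ∑ p, d p :=
        Finset.sum_le_sum_of_subset (Finset.subset_univ _)
      rw [hsum]
      simp only [Finsupp.add_apply, Finsupp.single_eq_same]
      omega)
    exact insertedThrough_of_mem hc.1.1 i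

/-- Every associated prime of a `P`-stable monomial ideal `L ⊆ k[x_P]` is of the
form `𝔭(I) = (x_p : p ∈ I)` for a poset ideal `I ⊆ P`. -/
theorem associatedPrime_of_pStable (k : Type*) [Field k] {P : Type*} [PartialOrder P]
    [Fintype P] (L : Ideal (MvPolynomial P k)) (hmono : IsMonomialIdeal k L)
    (hstable : PStable k L) (p : Ideal (MvPolynomial P k)) (hp : p.IsPrime)
    (hassoc : ∃ f : MvPolynomial P k, p = Submodule.colon L (Ideal.span {f})) :
    ∃ I : Set P, IsPosetIdeal I ∧
      p = Ideal.span ((fun a => (X a : MvPolynomial P k)) '' I) := by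
  obtain ⟨f, hf⟩ := hassoc
  have hpf (g : MvPolynomial P k) : g ∈ p ↔ g * f ∈ L := by
    rw [hf]
    exact Ideal.mem_colon_span_singleton
  obtain ⟨m⟩ := nonempty_monomialOrder P
  refine ⟨{a | X a ∈ p}, ?_, hmono.associatedPrime_eq_span_X m hp hpf⟩
  intro b hb a hab
  set N := f.support.sup (fun d => ∑ q, d q) + 2 with hN
  refine hp.mem_of_pow_mem (N + 1) ((hpf _).2 ((hmono.mem_iff _).2 fun c hc => ?_))
  rw [X_pow_eq_monomial, mem_support_iff, coeff_monomial_mul'] at hc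
  split_ifs at hc with hle
  · obtain ⟨d, rfl⟩ := exists_add_of_le hle
    rw [add_tsub_cancel_left, one_mul] at hc
    rw [add_comm]
    refine hstable.monomial_add_single_mem hab
      ((hmono.mem_iff _).1 ((hpf _).1 hb) _ ?_) ?_
    · rw [mem_support_iff, mul_comm, coeff_mul_X]
      exact hc
    · have := Finset.le_sup (f := fun d : P →₀ ℕ => ∑ q, d q) (mem_support_iff.2 hc)
      omega
  · exact absurd rfl hc
end

section
/- Let φ : P → ℕ be an isotone map and J(φ) = {ψ ∈ Hom(P,ℕ) : ψ ≤ φ} the principal poset ideal. The inclusion-minimal sets among the ascents Λψ for ψ in the complement filter J(φ)^c are exactly the sets {(p_0,0), (p_1,1), …, (p_r,r)} where p_0 ≤ p_1 ≤ ⋯ ≤ p_r is a multichain in P with φ(p_r) = r and φ(p_i) > i for all i < r. -/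
open MvPolynomial
open scoped Classical

/-- Below every `p` with `i < ψ p` there is a point `q` such that `(q, i)` lies in the ascent. -/
lemma exists_mem_ascent_le {P : Type*} [PartialOrder P] [Finite P] (ψ : P →o ℕ) {p : P} {i : ℕ}
    (h : i < ψ p) : ∃ q ≤ p, (q, i) ∈ ascent ψ := by
  obtain ⟨q, hqp, hq⟩ := (Set.toFinite {q : P | i < ψ q}).exists_le_minimal h
  refine ⟨q, hqp, hq.prop, fun s hs => ?_⟩
  by_contra! hlt
  exact hq.not_lt hlt hs

/-- If `k < ψ p` then the ascent of `ψ` contains a multichain below `p` running through the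
levels `0, …, k`. -/
lemma exists_multichain_mem_ascent {P : Type*} [PartialOrder P] [Finite P] (ψ : P →o ℕ) (k : ℕ)
    (p : P) (h : k < ψ p) :
    ∃ c : ℕ → P, Monotone c ∧ (∀ i ≤ k, (c i, i) ∈ ascent ψ) ∧ ∀ i, c i ≤ p := by
  induction k generalizing p with
  | zero =>
    obtain ⟨q, hqp, hq⟩ := exists_mem_ascent_le ψ h
    refine ⟨fun _ => q, monotone_const, fun i hi => ?_, fun _ => hqp⟩
    obtain rfl : i = 0 := by omega
    exact hq
  | succ k ih =>
    obtain ⟨q, hqp, hq⟩ := exists_mem_ascent_le ψ h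
    obtain ⟨c, hc, hmem, hle⟩ := ih q (by have := hq.1; dsimp only at this; omega)
    refine ⟨fun i => if i ≤ k then c i else q, fun i j hij => ?_, fun i hi => ?_, fun i => ?_⟩
    · dsimp only
      split_ifs with h1 h2 h2
      · exact hc hij
      · exact hle i
      · omega
      · exact le_rfl
    · dsimp only
      split_ifs with h1
      · exact hmem i h1
      · obtain rfl : i = k + 1 := by omega
        exact hq
    · dsimp only
      split_ifs
      · exact (hle i).trans hqp
      · exact hqp

/-- The isotone map sending `p` to the largest `j + 1` with `c j ≤ p`, or to `0` if there is
no such `j`. -/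
noncomputable def multichainMap {P : Type*} [PartialOrder P] {n : ℕ} (c : Fin n → P) :
    P →o ℕ where
  toFun p := Finset.univ.sup fun j : Fin n => if c j ≤ p then (j : ℕ) + 1 else 0
  monotone' p q hpq := by
    refine Finset.sup_mono_fun fun j _ => ?_
    split_ifs with h1 h2
    · exact le_rfl
    · exact absurd (h1.trans hpq) h2
    · exact Nat.zero_le _
    · exact le_rfl

lemma lt_multichainMap_iff {P : Type*} [PartialOrder P] {n : ℕ} {c : Fin n → P}
    (hc : Monotone c) {p : P} {i : ℕ} :
    i < multichainMap c p ↔ ∃ h : i < n, c ⟨i, h⟩ ≤ p := by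
  change i < Finset.univ.sup (fun j : Fin n => if c j ≤ p then (j : ℕ) + 1 else 0) ↔ _
  rw [Finset.lt_sup_iff]
  constructor
  · rintro ⟨j, -, hj⟩
    split_ifs at hj with h1
    · exact ⟨by omega, (hc (Fin.mk_le_of_le_val (by omega))).trans h1⟩
    · omega
  · rintro ⟨h, hp⟩
    exact ⟨⟨i, h⟩, Finset.mem_univ _, by simp [hp]⟩

lemma ascent_multichainMap {P : Type*} [PartialOrder P] {n : ℕ} {c : Fin n → P}
    (hc : Monotone c) :
    ascent (multichainMap c) = Set.range fun j : Fin n => (c j, (j : ℕ)) := by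
  ext ⟨p, i⟩
  constructor
  · rintro ⟨h1, h2⟩
    obtain ⟨hi, hp⟩ := (lt_multichainMap_iff hc).1 h1
    rcases hp.eq_or_lt with heq | hlt
    · exact ⟨⟨i, hi⟩, Prod.ext heq rfl⟩
    · exact absurd ((lt_multichainMap_iff hc).2 ⟨hi, le_rfl⟩) (h2 _ hlt).not_gt
  · rintro ⟨j, hj⟩
    obtain ⟨rfl, rfl⟩ := Prod.mk.inj hj
    refine ⟨(lt_multichainMap_iff hc).2 ⟨j.2, le_rfl⟩, fun q hq => ?_⟩
    by_contra! hlt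
    obtain ⟨_, hle⟩ := (lt_multichainMap_iff hc).1 hlt
    exact hq.not_ge hle

lemma multichainMap_not_le {P : Type*} [PartialOrder P] (φ : P →o ℕ) {r : ℕ}
    {c : Fin (r + 1) → P} (hc : Monotone c) (hr : φ (c (Fin.last r)) = r) :
    ¬ multichainMap c ≤ φ := by
  intro h
  have h1 : r < multichainMap c (c (Fin.last r)) :=
    (lt_multichainMap_iff hc).2 ⟨r.lt_succ_self, le_rfl⟩
  have h2 := h (c (Fin.last r))
  dsimp only at h2
  omega

/-- For a principal poset ideal `J(φ) = {ψ : ψ ≤ φ}`, the inclusion-minimal ascents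
`Λψ` for `ψ` in the complement filter `J(φ)^c` are exactly the sets
`{(p_0,0), …, (p_r,r)}` for multichains `p_0 ≤ ⋯ ≤ p_r` in `P` with `φ(p_r) = r` and
`φ(p_i) > i` for `i < r`. -/
theorem minimal_ascents_of_principal_posetIdeal {P : Type*} [PartialOrder P] [Fintype P]
    (φ : P →o ℕ) (A : Set (P × ℕ)) :
    (∃ ψ : P →o ℕ, ¬ψ ≤ φ ∧ A = ascent ψ ∧
      ∀ χ : P →o ℕ, ¬χ ≤ φ → ascent χ ⊆ A → ascent χ = A) ↔
    (∃ (r : ℕ) (c : Fin (r + 1) → P), Monotone c ∧ φ (c (Fin.last r)) = r ∧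
      (∀ j : Fin (r + 1), (j : ℕ) < r → (j : ℕ) < φ (c j)) ∧
      A = Set.range fun j : Fin (r + 1) => (c j, (j : ℕ))) := by
  constructor
  · rintro ⟨ψ, hψ, rfl, hmin⟩
    obtain ⟨p, hp⟩ : ∃ p, φ p < ψ p := by
      by_contra! h
      exact hψ h
    obtain ⟨c, hc, hmem, hle⟩ := exists_multichain_mem_ascent ψ (φ p) p hp
    have hex : ∃ i, φ (c i) ≤ i := ⟨φ p, φ.monotone (hle _)⟩
    obtain ⟨r, hr, hlt⟩ : ∃ r, φ (c r) ≤ r ∧ ∀ i < r, i < φ (c i) :=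
      ⟨Nat.find hex, Nat.find_spec hex, fun i hi => not_le.1 (Nat.find_min hex hi)⟩
    have hrp : r ≤ φ p := by
      by_contra! h
      exact (hlt _ h).not_ge (φ.monotone (hle _))
    have hreq : φ (c r) = r := by
      rcases r with _ | r
      · omega
      · have h1 := hlt r r.lt_succ_self
        have h2 : φ (c r) ≤ φ (c (r + 1)) := φ.monotone (hc r.le_succ)
        omega
    have hd : Monotone fun j : Fin (r + 1) => c j := fun i j hij => hc hij
    refine ⟨r, fun j => c j, hd, hreq, fun j hj => hlt j hj, ?_⟩
    rw [← ascent_multichainMap hd]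
    refine (hmin _ (multichainMap_not_le φ hd hreq) ?_).symm
    rw [ascent_multichainMap hd]
    rintro _ ⟨j, rfl⟩
    exact hmem j (by omega)
  · rintro ⟨r, c, hc, hr, hlt, rfl⟩
    refine ⟨multichainMap c, multichainMap_not_le φ hc hr, (ascent_multichainMap hc).symm,
      fun χ hχ hsub => hsub.antisymm ?_⟩
    obtain ⟨p, hp⟩ : ∃ p, φ p < χ p := by
      by_contra! h
      exact hχ h
    have key : ∀ i ≤ φ p, ∃ j : Fin (r + 1), (j : ℕ) = i ∧ c j ≤ p ∧ (c j, i) ∈ ascent χ := by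
      intro i hi
      obtain ⟨q, hqp, hq⟩ := exists_mem_ascent_le χ (hi.trans_lt hp)
      obtain ⟨j, hj⟩ := hsub hq
      obtain ⟨rfl, rfl⟩ := Prod.mk.inj hj
      exact ⟨j, rfl, hqp, hq⟩
    have hrp : r ≤ φ p := by
      obtain ⟨j, hj, hjp, -⟩ := key _ le_rfl
      by_contra! h
      have h1 := hlt j (by omega)
      have h2 := φ.monotone hjp
      omega
    rintro _ ⟨j, rfl⟩
    obtain ⟨j', hj', -, hmem⟩ := key j (by omega)
    obtain rfl := Fin.ext hj'
    exact hmem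
end

section
/- Let [m] = {1 < 2 < ⋯ < m} be the chain, J ⊆ Hom([m],ℕ) a poset ideal, and L^{p_1}(J,[m]) ⊆ k[x_1,…,x_m] the ideal generated by the images of the generators of the letterplace ideal L(J,[m]) under the substitution x_{a,i} ↦ x_a. Then L^{p_1}(J,[m]) is a strongly stable monomial ideal, and the assignment J ↦ L^{p_1}(J,[m]) is a one-to-one correspondence between poset ideals of Hom([m],ℕ) and strongly stable monomial ideals of k[x_1,…,x_m]. -/
open MvPolynomial
open scoped Classical

/-- The projected letterplace ideal `L^{p₁}(J,[m]) ⊆ k[x_1,…,x_m]` for the chain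
`[m]` (modelled by `Fin m`): generated by the images of the generators `m_{Λψ}`,
`ψ ∈ J^c`, of `L(J,[m])` under `x_{a,i} ↦ x_a`, i.e. by the monomials with exponent
vector `Λ̄ψ`. -/
noncomputable def projLetterplaceChain (k : Type*) [Field k] (m : ℕ)
    (J : Set (Fin m →o ℕ)) : Ideal (MvPolynomial (Fin m) k) :=
  Ideal.span {f | ∃ ψ : Fin m →o ℕ, ψ ∉ J ∧
    f = monomial (Finsupp.equivFunOnFinite.symm (lambdaBar ψ)) (1 : k)}

/-- A monomial ideal of `k[x_1,…,x_m]` is strongly stable if `x_j·n ∈ I` and `i < j`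
imply `x_i·n ∈ I`. -/
def StronglyStable (k : Type*) [Field k] {m : ℕ}
    (I : Ideal (MvPolynomial (Fin m) k)) : Prop :=
  ∀ (n : Fin m →₀ ℕ) (i j : Fin m), i < j →
    monomial (n + Finsupp.single j 1) (1 : k) ∈ I →
    monomial (n + Finsupp.single i 1) (1 : k) ∈ I

/-- The isotone map of partial sums `a ↦ ∑_{b ≤ a} d b` of an exponent vector `d`. -/
def partialSums {m : ℕ} (d : Fin m → ℕ) : Fin m →o ℕ where
  toFun a := ∑ b ∈ Finset.Iic a, d b
  monotone' _ _ h := Finset.sum_le_sum_of_subset (Finset.Iic_subset_Iic.2 h)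

lemma partialSums_apply {m : ℕ} (d : Fin m → ℕ) (a : Fin m) :
    partialSums d a = ∑ b ∈ Finset.Iic a, d b := rfl

lemma partialSums_eq_sum_Iio_add {m : ℕ} (d : Fin m → ℕ) (a : Fin m) :
    partialSums d a = ∑ b ∈ Finset.Iio a, d b + d a := by
  rw [partialSums_apply, ← Finset.Iio_insert, Finset.sum_insert (by simp), add_comm]

lemma Iio_eq_Iic_of_val_succ {m : ℕ} {p a : Fin m} (h : (p : ℕ) + 1 = a) :
    Finset.Iio a = Finset.Iic p := by
  ext x
  simp only [Finset.mem_Iio, Finset.mem_Iic, Fin.lt_def, Fin.le_def]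
  omega

lemma partialSums_succ {m : ℕ} (d : Fin m → ℕ) {p a : Fin m} (h : (p : ℕ) + 1 = a) :
    partialSums d a = partialSums d p + d a := by
  rw [partialSums_eq_sum_Iio_add, Iio_eq_Iic_of_val_succ h, partialSums_apply]

lemma partialSums_mono {m : ℕ} {d e : Fin m → ℕ} (h : d ≤ e) :
    partialSums d ≤ partialSums e :=
  fun _ => Finset.sum_le_sum fun b _ => h b

lemma partialSums_injective (m : ℕ) :
    Function.Injective (partialSums : (Fin m → ℕ) → Fin m →o ℕ) := by
  intro d e h
  funext a
  induction a using WellFoundedLT.induction with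
  | ind a ih =>
    have ha := DFunLike.congr_fun h a
    rw [partialSums_eq_sum_Iio_add, partialSums_eq_sum_Iio_add,
      Finset.sum_congr rfl fun b hb => ih b (Finset.mem_Iio.1 hb)] at ha
    exact Nat.add_left_cancel ha

lemma partialSums_add_single {m : ℕ} (d : Fin m →₀ ℕ) (i a : Fin m) :
    partialSums ⇑(d + Finsupp.single i 1 : Fin m →₀ ℕ) a = partialSums d a + if i ≤ a then 1 else 0 := by
  simp [partialSums_apply, Finset.sum_add_distrib, Finsupp.single_apply]

lemma partialSums_lambdaBar {m : ℕ} (ψ : Fin m →o ℕ) : partialSums (lambdaBar ψ) = ψ := by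
  ext ⟨n, hn⟩
  induction n with
  | zero =>
    have h0 : Finset.Iio (⟨0, hn⟩ : Fin m) = ∅ := by
      exact Finset.eq_empty_of_forall_notMem fun x hx =>
        Nat.not_lt_zero _ (Fin.lt_def.1 (Finset.mem_Iio.1 hx))
    have hs : {i : ℕ | ((⟨0, hn⟩ : Fin m), i) ∈ ascent ψ} = Set.Iio (ψ ⟨0, hn⟩) := by
      ext i
      exact and_iff_left fun q hq => absurd (Fin.lt_def.1 hq) (Nat.not_lt_zero _)
    rw [partialSums_eq_sum_Iio_add, h0, lambdaBar, hs]
    simp [← Finset.coe_Iio]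
  | succ n ih =>
    have hp : n < m := by omega
    have hle : ψ ⟨n, hp⟩ ≤ ψ ⟨n + 1, hn⟩ := ψ.monotone (by simp [Fin.le_def])
    have hs : {i : ℕ | ((⟨n + 1, hn⟩ : Fin m), i) ∈ ascent ψ} =
        Set.Ico (ψ ⟨n, hp⟩) (ψ ⟨n + 1, hn⟩) := by
      ext i
      simp only [ascent, Set.mem_ofPred_eq, Set.mem_Ico]
      constructor
      · exact fun h => ⟨h.2 _ (by simp [Fin.lt_def]), h.1⟩
      · refine fun h => ⟨h.2, fun q hq => (ψ.monotone ?_).trans h.1⟩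
        rw [Fin.lt_def] at hq
        exact Fin.le_def.2 (Nat.le_of_lt_succ hq)
    rw [partialSums_succ (p := ⟨n, hp⟩) _ rfl, ih hp, lambdaBar, hs, ← Finset.coe_Ico,
      Set.ncard_coe_finset, Nat.card_Ico]
    omega

lemma lambdaBar_partialSums {m : ℕ} (d : Fin m → ℕ) : lambdaBar (partialSums d) = d :=
  partialSums_injective m (partialSums_lambdaBar _)

/-- A set of exponent vectors stable under multiplication by variables and under the strongly
stable exchanges is upward closed for the dominance order of partial sums. -/
lemma mem_of_partialSums_le {m : ℕ} {E : Set (Fin m →₀ ℕ)}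
    (hadd : ∀ d ∈ E, ∀ i, d + Finsupp.single i 1 ∈ E)
    (hexch : ∀ (n : Fin m →₀ ℕ) (i j : Fin m), i < j →
      n + Finsupp.single j 1 ∈ E → n + Finsupp.single i 1 ∈ E)
    {d e : Fin m →₀ ℕ} (hd : d ∈ E) (hle : partialSums d ≤ partialSums e) : e ∈ E := by
  induction hN : ∑ a, (partialSums e a - partialSums d a) using Nat.strong_induction_on
    generalizing d with
  | _ N ih =>
  subst hN
  by_cases heq : partialSums d = partialSums e
  · rwa [← DFunLike.coe_injective (partialSums_injective m heq)]
  have step : ∀ d' ∈ E, partialSums d ≤ partialSums d' → partialSums d' ≤ partialSums e →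
      (∃ a, partialSums d a < partialSums d' a) → e ∈ E := by
    rintro d' hd' h₁ h₂ ⟨a, ha⟩
    refine ih _ (Finset.sum_lt_sum (fun b _ => Nat.sub_le_sub_left (h₁ b) _)
      ⟨a, Finset.mem_univ a, ?_⟩) hd' h₂ rfl
    exact Nat.sub_lt_sub_left (ha.trans_le (h₂ a)) ha
  obtain ⟨a, ha⟩ : ∃ a, partialSums d a < partialSums e a := by
    by_contra! h
    exact heq (le_antisymm hle h)
  by_cases hc : ∃ c, a < c ∧ partialSums d c = partialSums e c
  · obtain ⟨c, ⟨hac, hc⟩, hmin⟩ := WellFounded.has_min (wellFounded_lt (α := Fin m))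
      {c | a < c ∧ partialSums d c = partialSums e c} hc
    have hlt : ∀ b, a ≤ b → b < c → partialSums d b < partialSums e b := by
      intro b hab hbc
      rcases hab.eq_or_lt with rfl | hab
      · exact ha
      · exact lt_of_le_of_ne (hle b) fun h => hmin b ⟨hab, h⟩ hbc
    have hpos : 1 ≤ d c := by
      have hac' := Fin.lt_def.1 hac
      have hsucc : ((⟨c - 1, by omega⟩ : Fin m) : ℕ) + 1 = c := by
        simp only; omega
      have h := hlt ⟨c - 1, by omega⟩ (by rw [Fin.le_def]; simp only; omega)
        (by rw [Fin.lt_def]; simp only; omega)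
      rw [partialSums_succ d hsucc, partialSums_succ e hsucc] at hc
      omega
    obtain ⟨n, rfl⟩ : ∃ n, d = n + Finsupp.single c 1 :=
      ⟨d - Finsupp.single c 1, (tsub_add_cancel_of_le (Finsupp.single_le_iff.2 hpos)).symm⟩
    refine step _ (hexch n a c hac hd) (fun b => ?_) (fun b => ?_) ⟨a, ?_⟩
    · change partialSums _ b ≤ partialSums _ b
      rw [partialSums_add_single, partialSums_add_single]
      split_ifs <;> omega
    · have h₁ := hle b
      have h₂ := hlt b
      change partialSums _ b ≤ partialSums _ b at h₁ ⊢
      rw [partialSums_add_single] at h₁ h₂ ⊢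
      rw [← not_le] at h₂
      split_ifs at * <;> simp_all
      omega
    · rw [partialSums_add_single, partialSums_add_single]
      simp [not_le.2 hac]
  · push Not at hc
    refine step _ (hadd d hd a) (partialSums_mono (by simp)) (fun b => ?_) ⟨a, ?_⟩
    · change partialSums _ b ≤ partialSums _ b
      rw [partialSums_add_single]
      split_ifs with hab
      · rcases hab.eq_or_lt with rfl | hab
        · exact ha
        · exact lt_of_le_of_ne (hle b) (hc b hab)
      · exact hle b
    · rw [partialSums_add_single]
      simp

lemma monomial_mem_projLetterplaceChain_iff {k : Type*} [Field k] {m : ℕ}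
    {J : Set (Fin m →o ℕ)} (hJ : IsPosetIdeal J) (d : Fin m →₀ ℕ) :
    monomial d (1 : k) ∈ projLetterplaceChain k m J ↔ partialSums d ∉ J := by
  have himage : {f | ∃ ψ : Fin m →o ℕ, ψ ∉ J ∧
      f = monomial (Finsupp.equivFunOnFinite.symm (lambdaBar ψ)) (1 : k)} =
      (fun s => monomial s (1 : k)) ''
        {s | ∃ ψ ∉ J, s = Finsupp.equivFunOnFinite.symm (lambdaBar ψ)} := by
    ext f
    constructor
    · rintro ⟨ψ, hψ, rfl⟩
      exact ⟨_, ⟨ψ, hψ, rfl⟩, rfl⟩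
    · rintro ⟨_, ⟨ψ, hψ, rfl⟩, rfl⟩
      exact ⟨ψ, hψ, rfl⟩
  rw [projLetterplaceChain, himage, mem_ideal_span_monomial_image,
    support_monomial, if_neg one_ne_zero]
  simp only [Finset.mem_singleton, forall_eq]
  constructor
  · rintro ⟨_, ⟨ψ, hψ, rfl⟩, hle⟩ hd
    refine hψ (hJ _ hd ψ ?_)
    conv_lhs => rw [← partialSums_lambdaBar ψ]
    exact partialSums_mono hle
  · intro hd
    refine ⟨d, ⟨_, hd, ?_⟩, le_rfl⟩
    rw [lambdaBar_partialSums]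
    ext; rfl

/-- The projected letterplace ideal `L^{p₁}(J,[m])` of a poset ideal
`J ⊆ Hom([m],ℕ)` is strongly stable, and `J ↦ L^{p₁}(J,[m])` is a one-to-one
correspondence between poset ideals of `Hom([m],ℕ)` and strongly stable monomial
ideals of `k[x_1,…,x_m]`. -/
theorem projLetterplace_stronglyStable_correspondence (k : Type*) [Field k] (m : ℕ) :
    (∀ J : Set (Fin m →o ℕ), IsPosetIdeal J → StronglyStable k (projLetterplaceChain k m J)) ∧
    (∀ J J' : Set (Fin m →o ℕ), IsPosetIdeal J → IsPosetIdeal J' →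
      projLetterplaceChain k m J = projLetterplaceChain k m J' → J = J') ∧
    (∀ I : Ideal (MvPolynomial (Fin m) k), IsMonomialIdeal k I → StronglyStable k I →
      ∃ J : Set (Fin m →o ℕ), IsPosetIdeal J ∧ I = projLetterplaceChain k m J) := by
  refine ⟨fun J hJ n i j hij h => ?_, fun J J' hJ hJ' h => ?_, fun I hI hs => ?_⟩
  · rw [monomial_mem_projLetterplaceChain_iff hJ] at h ⊢
    refine fun h' => h (hJ _ h' _ fun b => ?_)
    change partialSums _ b ≤ partialSums _ b
    rw [partialSums_add_single, partialSums_add_single]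
    split_ifs <;> omega
  · ext ψ
    have h₁ := monomial_mem_projLetterplaceChain_iff (k := k) hJ
      (Finsupp.equivFunOnFinite.symm (lambdaBar ψ))
    have h₂ := monomial_mem_projLetterplaceChain_iff (k := k) hJ'
      (Finsupp.equivFunOnFinite.symm (lambdaBar ψ))
    rw [Finsupp.coe_equivFunOnFinite_symm, partialSums_lambdaBar] at h₁ h₂
    exact not_iff_not.1 (h₁.symm.trans (h ▸ h₂))
  · let e : (Fin m →o ℕ) → Fin m →₀ ℕ := fun ψ => Finsupp.equivFunOnFinite.symm (lambdaBar ψ)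
    have he : ∀ ψ, partialSums (e ψ) = ψ := partialSums_lambdaBar
    refine ⟨{ψ | monomial (e ψ) (1 : k) ∉ I}, fun ψ hψ φ hφ h => hψ ?_, ?_⟩
    · refine mem_of_partialSums_le (E := {d | monomial d (1 : k) ∈ I}) (fun d hd i => ?_) hs h
        (by rwa [he, he])
      have := I.mul_mem_right (monomial (Finsupp.single i 1) (1 : k)) hd
      rwa [monomial_mul, one_mul] at this
    · conv_lhs => rw [hI]
      refine congrArg Ideal.span (Set.ext fun f => ⟨?_, ?_⟩)
      · rintro ⟨d, rfl, hd⟩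
        have hd' : e (partialSums d) = d := by
          ext a
          exact congrFun (lambdaBar_partialSums d) a
        exact ⟨partialSums d, not_not.2 (by rwa [hd']), by rw [← hd']; simp only [he]; rfl⟩
      · rintro ⟨ψ, hψ, rfl⟩
        exact ⟨_, rfl, not_not.1 hψ⟩
end

section
/- Let [m] = {1 < 2 < ⋯ < m} be the chain, J ⊆ Hom([m],ℕ) a poset ideal, and L^{p_2}([m],J) ⊆ k[x_ℕ] = k[x_0, x_1, x_2, …] the ideal generated by the monomials ∏_{a∈I} x_{α(a)} over all markers (I,α) of J. Then L^{p_2}([m],J) is a strongly stable ideal generated in degrees at most m (hence m-regular), and the assignment J ↦ L^{p_2}([m],J) is a one-to-one correspondence between poset ideals of Hom([m],ℕ) and finitely generated strongly stable ideals of k[x_ℕ] generated in degrees at most m. -/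
open MvPolynomial
open scoped Classical

/-- The projected co-letterplace ideal `L^{p₂}([m],J) ⊆ k[x_ℕ]` for the chain `[m]`
(modelled by `Fin m`): generated by the monomials `∏_{a∈I} x_{α(a)}` over all markers
`(I,α)` of `J`. -/
noncomputable def projCoLetterplaceChain (k : Type*) [Field k] (m : ℕ)
    (J : Set (Fin m →o ℕ)) : Ideal (MvPolynomial ℕ k) :=
  Ideal.span {f | ∃ (I : Set (Fin m)) (α : I → ℕ), IsMarker J I α ∧
    f = ∏ a : I, (X (α a) : MvPolynomial ℕ k)}

/-- A monomial ideal of `k[x_ℕ]` is strongly stable if `x_j·n ∈ I` and `i < j`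
imply `x_i·n ∈ I`. -/
def StronglyStableN (k : Type*) [Field k] (I : Ideal (MvPolynomial ℕ k)) : Prop :=
  ∀ (n : ℕ →₀ ℕ) (i j : ℕ), i < j →
    monomial (n + Finsupp.single j 1) (1 : k) ∈ I →
    monomial (n + Finsupp.single i 1) (1 : k) ∈ I

/-- `I` is a (finitely generated) monomial ideal generated in degrees at most `m`. -/
def GeneratedInDegreesLE (k : Type*) [Field k] (I : Ideal (MvPolynomial ℕ k)) (m : ℕ) :
    Prop :=
  ∃ G : Finset (ℕ →₀ ℕ), (∀ d ∈ G, (d.sum fun _ e => e) ≤ m) ∧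
    I = Ideal.span ((fun d => monomial d (1 : k)) '' G)

/-- The exponent vector of the monomial `∏ i, x_{a i}` of a finite family of variables. -/
noncomputable def exponentOf {ι : Type*} [Fintype ι] (a : ι → ℕ) : ℕ →₀ ℕ :=
  ∑ i, Finsupp.single (a i) 1

lemma exponentOf_apply {ι : Type*} [Fintype ι] (a : ι → ℕ) (v : ℕ) :
    exponentOf a v = Fintype.card {i // a i = v} := by
  rw [exponentOf, Finsupp.finsetSum_apply, Fintype.card_subtype, Finset.card_filter]
  exact Finset.sum_congr rfl fun i _ => Finsupp.single_apply

lemma exponentOf_eq_zero {ι : Type*} [Fintype ι] {a : ι → ℕ} {v : ℕ} (h : ∀ i, a i ≠ v) :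
    exponentOf a v = 0 := by
  rw [exponentOf_apply, Fintype.card_eq_zero_iff]
  exact ⟨fun i => h i.1 i.2⟩

lemma exponentOf_apply_le_card {ι : Type*} [Fintype ι] (a : ι → ℕ) (v : ℕ) :
    exponentOf a v ≤ Fintype.card ι := by
  rw [exponentOf_apply]
  exact Fintype.card_subtype_le _

lemma exponentOf_restrict_le {ι : Type*} [Fintype ι] (S : Set ι) (a : ι → ℕ) :
    exponentOf (fun p : S => a p) ≤ exponentOf a := fun v => by
  rw [exponentOf_apply, exponentOf_apply]
  exact Fintype.card_le_of_injective (fun p => ⟨p.1.1, p.2⟩) fun p q hpq =>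
    Subtype.ext (Subtype.ext (congrArg Subtype.val hpq :))

lemma exponentOf_sum {ι : Type*} [Fintype ι] (a : ι → ℕ) :
    ((exponentOf a).sum fun _ e => e) = Fintype.card ι := by
  rw [exponentOf, ← Finsupp.sum_finsetSum_index (fun _ => rfl) (fun _ _ _ => rfl)]
  simp

lemma prod_X_eq_monomial_exponentOf (k : Type*) [Field k] {ι : Type*} [Fintype ι]
    (a : ι → ℕ) : ∏ i, (X (a i) : MvPolynomial ℕ k) = monomial (exponentOf a) 1 := by
  simp only [exponentOf, monomial_sum_one, X]

lemma exponentOf_comp_equiv {ι κ : Type*} [Fintype ι] [Fintype κ] (a : κ → ℕ) (e : ι ≃ κ) :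
    exponentOf (a ∘ e) = exponentOf a :=
  e.sum_comp fun i => Finsupp.single (a i) 1

/-- A divisor relation between monomials comes from an embedding of the families of variables. -/
lemma exists_embedding_of_exponentOf_le {ι κ : Type*} [Fintype ι] [Fintype κ] {a : ι → ℕ}
    {b : κ → ℕ} (h : exponentOf a ≤ exponentOf b) : ∃ σ : ι ↪ κ, ∀ i, b (σ i) = a i := by
  have e : ∀ v, {i // a i = v} ↪ {i // b i = v} := fun v =>
    (Function.Embedding.nonempty_of_card_le (by simpa only [exponentOf_apply] using h v)).some
  refine ⟨⟨fun i => (e (a i) ⟨i, rfl⟩).1, fun i j hij => ?_⟩, fun i => (e (a i) ⟨i, rfl⟩).2⟩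
  have key : ∀ v w (x : {i // a i = v}) (y : {i // a i = w}),
      (e v x).1 = (e w y).1 → x.1 = y.1 := by
    intro v w x y hxy
    obtain rfl : v = w := by rw [← (e v x).2, ← (e w y).2, hxy]
    rw [(e v).injective (Subtype.ext hxy)]
  exact key _ _ ⟨i, rfl⟩ ⟨j, rfl⟩ hij

/-- Replacing one variable in a monomial. -/
lemma exists_exponentOf_update {ι : Type*} [Fintype ι] [DecidableEq ι] (a : ι → ℕ) (i : ι) :
    ∃ n, exponentOf a = n + Finsupp.single (a i) 1 ∧
      ∀ v, exponentOf (Function.update a i v) = n + Finsupp.single v 1 := by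
  refine ⟨∑ j ∈ Finset.univ.erase i, Finsupp.single (a j) 1, ?_, fun v => ?_⟩
  · exact (Finset.sum_erase_add _ _ (Finset.mem_univ i)).symm
  · rw [exponentOf, ← Finset.sum_erase_add _ _ (Finset.mem_univ i), Function.update_self]
    congr 1
    refine Finset.sum_congr rfl fun j hj => ?_
    rw [Function.update_of_ne (Finset.ne_of_mem_erase hj)]

lemma exists_exponentOf_eq {ι : Type*} [Fintype ι] (d : ℕ →₀ ℕ)
    (h : (d.sum fun _ e => e) = Fintype.card ι) : ∃ a : ι → ℕ, exponentOf a = d := by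
  have hl : Fintype.card ι = Fintype.card (Fin d.toMultiset.toList.length) := by
    rw [Fintype.card_fin, Multiset.length_toList, Finsupp.card_toMultiset, ← h]
    rfl
  refine ⟨d.toMultiset.toList.get ∘ Fintype.equivOfCardEq hl, ?_⟩
  rw [exponentOf_comp_equiv]
  apply Finsupp.orderIsoMultiset.injective
  rw [Finsupp.coe_orderIsoMultiset]
  rw [exponentOf, Finsupp.toMultiset_sum]
  simp only [Finsupp.toMultiset_single, one_smul]
  conv_rhs => rw [← Multiset.coe_toList d.toMultiset]
  generalize d.toMultiset.toList = l
  rw [← Multiset.sum_map_singleton (l : Multiset ℕ), Multiset.map_coe, Multiset.sum_coe,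
    ← List.sum_ofFn]
  congr 1
  apply List.ext_get <;> simp

lemma exists_perm_monotone {ι : Type*} [Fintype ι] [LinearOrder ι] (a : ι → ℕ) :
    ∃ σ : Equiv.Perm ι, Monotone (a ∘ σ) := by
  let e := monoEquivOfFin ι rfl
  refine ⟨(e.symm.toEquiv.trans (Tuple.sort (a ∘ e))).trans e.toEquiv, ?_⟩
  exact (Tuple.monotone_sort (a ∘ e)).comp e.symm.monotone

/-- An injective map on a lower set of a finite chain moves some element below `p` weakly
above `p`. -/
lemma exists_le_le_apply {P : Type*} [Fintype P] [LinearOrder P] {I : Set P}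
    (hI : IsPosetIdeal I) {σ : I → P} (hσ : Function.Injective σ) (p : I) :
    ∃ q ≤ p, (p : P) ≤ σ q := by
  by_contra! h
  let f : {q : P // q ≤ p} → {q : P // q < p} := fun q =>
    ⟨σ ⟨q.1, hI p p.2 q.1 q.2⟩, h ⟨q.1, hI p p.2 q.1 q.2⟩ q.2⟩
  have hf : Function.Injective f := fun q r hqr => by
    have := hσ (congrArg Subtype.val hqr)
    exact Subtype.ext (congrArg Subtype.val this :)
  have hcard := Fintype.card_le_of_injective f hf
  rw [Fintype.card_subtype, Fintype.card_subtype] at hcard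
  refine absurd hcard (not_le.2 (Finset.card_lt_card ?_))
  rw [Finset.ssubset_iff_of_subset fun q => by simpa using le_of_lt]
  exact ⟨p, by simp⟩

/-- A partial isotone map extends to an isotone map which is above a given one off its domain. -/
lemma exists_extension {P : Type*} [Fintype P] [LinearOrder P] {I : Set P}
    (hI : IsPosetIdeal I) {α : I → ℕ} (hα : Monotone α) (φ : P →o ℕ) :
    ∃ ψ : P →o ℕ, (∀ p : I, ψ p = α p) ∧ ∀ p ∉ I, φ p ≤ ψ p := by
  have hmono : Monotone fun p => if h : p ∈ I then α ⟨p, h⟩ else φ p + ∑ q, α q := by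
    intro p q hpq
    by_cases hq : q ∈ I
    · have hp := hI q hq p hpq
      simpa only [hp, hq, dif_pos] using hα (show (⟨p, hp⟩ : I) ≤ ⟨q, hq⟩ from hpq)
    · by_cases hp : p ∈ I
      · simp only [hp, hq, dif_pos, dif_neg, not_false_eq_true]
        exact (Finset.single_le_sum (f := α) (fun _ _ => Nat.zero_le _)
          (Finset.mem_univ _)).trans (Nat.le_add_left _ _)
      · simpa only [hp, hq, dif_neg, not_false_eq_true] using
          Nat.add_le_add_right (φ.monotone hpq) _
  refine ⟨⟨_, hmono⟩, fun p => dif_pos p.2, fun p hp => ?_⟩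
  simp only [OrderHom.coe_mk, hp, dif_neg, not_false_eq_true, Nat.le_add_right]

/-- A map lying below a marker on its domain belongs to the poset ideal. -/
lemma IsMarker.mem_of_le {P : Type*} [Fintype P] [LinearOrder P] {J : Set (P →o ℕ)}
    (hJ : IsPosetIdeal J) {I : Set P} {α : I → ℕ} (h : IsMarker J I α) {φ : P →o ℕ}
    (hφ : ∀ p : I, φ p ≤ α p) : φ ∈ J := by
  obtain ⟨ψ, hψ, hle⟩ := exists_extension h.1 h.2.1 φ
  refine hJ ψ (h.2.2 ψ hψ) φ fun p => ?_
  by_cases hp : p ∈ I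
  · exact (hφ ⟨p, hp⟩).trans (hψ ⟨p, hp⟩).ge
  · exact hle p hp

lemma isMarker_univ {P : Type*} [PartialOrder P] {J : Set (P →o ℕ)} {φ : P →o ℕ} (hφ : φ ∈ J) :
    IsMarker J Set.univ (fun p => φ p) := by
  refine ⟨fun _ _ _ _ => trivial, fun p q hpq => φ.monotone hpq, fun ψ hψ => ?_⟩
  obtain rfl : ψ = φ := OrderHom.ext _ _ (funext fun p => hψ ⟨p, trivial⟩)
  exact hφ

/-- Membership in a poset ideal of isotone maps on a finite chain only depends on a truncation. -/
lemma exists_truncation_bound {P : Type*} [Fintype P] [PartialOrder P] {J : Set (P →o ℕ)}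
    (hJ : IsPosetIdeal J) :
    ∃ N : ℕ, ∀ φ ψ : P →o ℕ, ψ ∈ J → (∀ p, min (φ p) N ≤ ψ p) → φ ∈ J := by
  have : WellQuasiOrderedLE (P →o ℕ) :=
    ⟨fun f => wellQuasiOrdered_le (α := P → ℕ) fun n => f n⟩
  have hfin : {φ | Minimal (· ∉ J) φ}.Finite :=
    WellQuasiOrderedLE.finite_of_isAntichain (setOfPred_minimal_antichain _)
  refine ⟨∑ φ ∈ hfin.toFinset, ∑ p, φ p, fun φ ψ hψ hle => ?_⟩
  by_contra hφ
  obtain ⟨χ, hχφ, hχ⟩ := exists_minimal_le_of_wellFoundedLT (· ∉ J) φ hφ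
  refine hχ.prop (hJ ψ hψ χ fun p => le_trans (le_min (hχφ p) ?_) (hle p))
  exact (Finset.single_le_sum (f := fun p => χ p) (fun _ _ => Nat.zero_le _)
    (Finset.mem_univ p)).trans (Finset.single_le_sum (f := fun φ : P →o ℕ => ∑ p, φ p)
      (fun _ _ => Nat.zero_le _) (hfin.mem_toFinset.2 hχ))

/-- The exponent vectors of the monomials of the markers of `J`. -/
def markerExponents {P : Type*} [Fintype P] [PartialOrder P] (J : Set (P →o ℕ)) :
    Set (ℕ →₀ ℕ) :=
  {d | ∃ (I : Set P) (α : I → ℕ), IsMarker J I α ∧ d = exponentOf α}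

lemma monomial_mem_span_iff (k : Type*) [Field k] (S : Set (ℕ →₀ ℕ)) (d : ℕ →₀ ℕ) :
    monomial d (1 : k) ∈ Ideal.span ((fun d => monomial d (1 : k)) '' S) ↔ ∃ s ∈ S, s ≤ d := by
  rw [mem_ideal_span_monomial_image, support_monomial, if_neg one_ne_zero]
  simp

lemma projCoLetterplaceChain_eq_span (k : Type*) [Field k] (m : ℕ) (J : Set (Fin m →o ℕ)) :
    projCoLetterplaceChain k m J =
      Ideal.span ((fun d => monomial d (1 : k)) '' markerExponents J) := by
  unfold projCoLetterplaceChain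
  congr 1
  ext f
  simp only [prod_X_eq_monomial_exponentOf]
  constructor
  · rintro ⟨I, α, h, rfl⟩
    exact ⟨_, ⟨I, α, h, rfl⟩, rfl⟩
  · rintro ⟨_, ⟨I, α, h, rfl⟩, rfl⟩
    exact ⟨I, α, h, rfl⟩

/-- Sorting a family of variables lying below a marker gives a marker. -/
lemma IsMarker.exponentOf_mem_markerExponents {P : Type*} [Fintype P] [LinearOrder P]
    {J : Set (P →o ℕ)} (hJ : IsPosetIdeal J) {I : Set P} {α : I → ℕ} (h : IsMarker J I α)
    {a : I → ℕ} (ha : a ≤ α) : exponentOf a ∈ markerExponents J := by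
  obtain ⟨σ, hσ⟩ := exists_perm_monotone a
  refine ⟨I, a ∘ σ, ⟨h.1, hσ, fun φ hφ => h.mem_of_le hJ fun p => ?_⟩,
    (exponentOf_comp_equiv a σ).symm⟩
  obtain ⟨q, hqp, hpq⟩ := exists_le_le_apply h.1
    (Subtype.val_injective.comp σ.symm.injective) p
  calc φ p = (a ∘ σ) p := hφ p
    _ ≤ (a ∘ σ) (σ.symm q) := hσ hpq
    _ = a q := by simp
    _ ≤ α q := ha q
    _ ≤ α p := h.2.1 hqp

lemma stronglyStableN_projCoLetterplaceChain (k : Type*) [Field k] (m : ℕ)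
    {J : Set (Fin m →o ℕ)} (hJ : IsPosetIdeal J) :
    StronglyStableN k (projCoLetterplaceChain k m J) := by
  intro n i j hij
  rw [projCoLetterplaceChain_eq_span, monomial_mem_span_iff, monomial_mem_span_iff]
  rintro ⟨_, ⟨I, α, h, rfl⟩, hle⟩
  by_cases hj : ∃ p, α p = j
  · obtain ⟨p, rfl⟩ := hj
    obtain ⟨n', hn', hupd⟩ := exists_exponentOf_update α p
    refine ⟨exponentOf (Function.update α p i), h.exponentOf_mem_markerExponents hJ
      (update_le_self_iff.2 hij.le), ?_⟩
    rw [hn'] at hle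
    refine (hupd i).trans_le ?_
    gcongr
    exact le_of_add_le_add_right hle
  · push Not at hj
    refine ⟨_, ⟨I, α, h, rfl⟩, le_trans (fun v => ?_) le_self_add⟩
    by_cases hv : v = j
    · rw [exponentOf_eq_zero (hv ▸ hj)]
      exact Nat.zero_le _
    · simpa [Finsupp.single_apply, Ne.symm hv] using hle v

lemma generatedInDegreesLE_projCoLetterplaceChain (k : Type*) [Field k] (m : ℕ)
    {J : Set (Fin m →o ℕ)} (hJ : IsPosetIdeal J) :
    GeneratedInDegreesLE k (projCoLetterplaceChain k m J) m := by
  obtain ⟨N, hN⟩ := exists_truncation_bound hJ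
  have hcard : ∀ I : Set (Fin m), Fintype.card I ≤ m := fun I => by
    simpa using Fintype.card_subtype_le (· ∈ I)
  have hfin : {d ∈ markerExponents J | ∀ v ≥ N, d v = 0}.Finite := by
    refine (Set.finite_Iic (∑ v ∈ Finset.range N, Finsupp.single v m)).subset ?_
    rintro _ ⟨⟨I, α, h, rfl⟩, hd⟩ v
    by_cases hv : v < N
    · simpa [Finsupp.finsetSum_apply, Finsupp.single_apply, hv] using
        (exponentOf_apply_le_card α v).trans (hcard I)
    · rw [hd v (not_lt.1 hv)]
      exact Nat.zero_le _
  refine ⟨hfin.toFinset, fun d hd => ?_, ?_⟩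
  · obtain ⟨⟨I, α, h, rfl⟩, -⟩ := hfin.mem_toFinset.1 hd
    exact (exponentOf_sum α).trans_le (hcard I)
  rw [projCoLetterplaceChain_eq_span, hfin.coe_toFinset]
  refine le_antisymm (Ideal.span_le.2 ?_) (Ideal.span_mono (Set.image_mono fun d hd => hd.1))
  rintro _ ⟨_, ⟨I, α, h, rfl⟩, rfl⟩
  refine (monomial_mem_span_iff k _ _).2 ?_
  obtain ⟨I', hI'⟩ : ∃ I' : Set (Fin m), ∀ p, p ∈ I' ↔ ∃ hp : p ∈ I, α ⟨p, hp⟩ < N :=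
    ⟨{p | ∃ hp : p ∈ I, α ⟨p, hp⟩ < N}, fun _ => Iff.rfl⟩
  let ι : I' → I := fun p => ⟨p.1, ((hI' p.1).1 p.2).1⟩
  have hι : Function.Injective ι := fun p q hpq =>
    Subtype.ext (congrArg Subtype.val hpq :)
  have hιN : ∀ p, α (ι p) < N := fun p => ((hI' p.1).1 p.2).2
  refine ⟨exponentOf (α ∘ ι), ⟨⟨I', α ∘ ι, ⟨?_, ?_, ?_⟩, rfl⟩, ?_⟩, ?_⟩
  · intro p hp q hqp
    have hq : q ∈ I := h.1 p (ι ⟨p, hp⟩).2 q hqp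
    exact (hI' q).2 ⟨hq, lt_of_le_of_lt
      (h.2.1 (show (⟨q, hq⟩ : I) ≤ ι ⟨p, hp⟩ from hqp)) (hιN ⟨p, hp⟩)⟩
  · exact fun p q hpq => h.2.1 hpq
  · intro φ hφ
    obtain ⟨ψ, hψ, hle⟩ := exists_extension h.1 h.2.1 φ
    refine hN φ ψ (h.2.2 ψ hψ) fun p => ?_
    by_cases hp : p ∈ I
    · rw [hψ ⟨p, hp⟩]
      by_cases hpN : α ⟨p, hp⟩ < N
      · exact (min_le_left _ _).trans (hφ ⟨p, (hI' p).2 ⟨hp, hpN⟩⟩).le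
      · exact (min_le_right _ _).trans (not_lt.1 hpN)
    · exact (min_le_left _ _).trans (hle p hp)
  · exact fun v hv => exponentOf_eq_zero fun p => (lt_of_lt_of_le (hιN p) hv).ne
  · intro v
    rw [exponentOf_apply, exponentOf_apply]
    exact Fintype.card_le_of_injective (fun p => ⟨ι p.1, p.2⟩) fun p q hpq =>
      Subtype.ext (hι (congrArg Subtype.val hpq))

/-- A poset ideal is recovered from the monomials of full degree in its ideal. -/
lemma monomial_exponentOf_mem_projCoLetterplaceChain_iff (k : Type*) [Field k] (m : ℕ)
    {J : Set (Fin m →o ℕ)} (hJ : IsPosetIdeal J) (φ : Fin m →o ℕ) :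
    monomial (exponentOf φ) (1 : k) ∈ projCoLetterplaceChain k m J ↔ φ ∈ J := by
  rw [projCoLetterplaceChain_eq_span, monomial_mem_span_iff]
  constructor
  · rintro ⟨_, ⟨I, α, h, rfl⟩, hle⟩
    obtain ⟨σ, hσ⟩ := exists_embedding_of_exponentOf_le hle
    refine h.mem_of_le hJ fun p => ?_
    obtain ⟨q, hqp, hpq⟩ := exists_le_le_apply h.1 σ.injective p
    calc φ p ≤ φ (σ q) := φ.monotone hpq
      _ = α q := hσ q
      _ ≤ α p := h.2.1 hqp
  · intro hφ
    exact ⟨_, ⟨Set.univ, _, isMarker_univ hφ, rfl⟩, exponentOf_restrict_le Set.univ φ⟩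

lemma StronglyStableN.monomial_exponentOf_mem {k : Type*} [Field k]
    {I : Ideal (MvPolynomial ℕ k)} (hI : StronglyStableN k I) {ι : Type*} [Fintype ι]
    {a b : ι → ℕ} (hab : a ≤ b) (hb : monomial (exponentOf b) (1 : k) ∈ I) :
    monomial (exponentOf a) (1 : k) ∈ I := by
  have key : ∀ s : Finset ι, monomial (exponentOf (s.piecewise a b)) (1 : k) ∈ I := by
    intro s
    induction s using Finset.induction_on with
    | empty => simpa using hb
    | insert i s hi ih =>
      rw [Finset.piecewise_insert]
      obtain ⟨n, hn, hupd⟩ := exists_exponentOf_update (s.piecewise a b) i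
      rw [Finset.piecewise_eq_of_notMem _ _ _ hi] at hn
      rw [hupd]
      rw [hn] at ih
      rcases (hab i).eq_or_lt with h | h
      · rwa [h]
      · exact hI n _ _ h ih
  simpa using key Finset.univ

/-- The isotone maps whose monomial lies in an ideal. -/
def isotoneMapsOf (k : Type*) [Field k] (m : ℕ) (I : Ideal (MvPolynomial ℕ k)) :
    Set (Fin m →o ℕ) :=
  {φ | monomial (exponentOf φ) (1 : k) ∈ I}

lemma eq_projCoLetterplaceChain_isotoneMapsOf (k : Type*) [Field k] (m : ℕ)
    {I : Ideal (MvPolynomial ℕ k)} (hgen : GeneratedInDegreesLE k I m) :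
    I = projCoLetterplaceChain k m (isotoneMapsOf k m I) := by
  obtain ⟨G, hG, rfl⟩ := hgen
  rw [projCoLetterplaceChain_eq_span]
  apply le_antisymm <;> rw [Ideal.span_le]
  · rintro _ ⟨d, hd, rfl⟩
    obtain ⟨S, hmem⟩ : ∃ S : Set (Fin m), ∀ p, p ∈ S ↔ p.1 < d.sum fun _ e => e :=
      ⟨{p | p.1 < d.sum fun _ e => e}, fun _ => Iff.rfl⟩
    have hS : (d.sum fun _ e => e) = Fintype.card S := by
      rw [← Fintype.card_congr ((Fin.castLEquiv (hG d hd)).trans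
        (Equiv.subtypeEquivRight fun p => (hmem p).symm)), Fintype.card_fin]
    obtain ⟨a, ha⟩ := exists_exponentOf_eq d hS
    obtain ⟨σ, hσ⟩ := exists_perm_monotone a
    rw [← exponentOf_comp_equiv a σ] at ha
    refine Ideal.subset_span ⟨d, ⟨S, a ∘ σ, ⟨fun p hp q hqp => ?_, hσ, fun φ hφ => ?_⟩,
      ha.symm⟩, rfl⟩
    · exact (hmem q).2 (lt_of_le_of_lt (show q.1 ≤ p.1 from hqp) ((hmem p).1 hp))
    · refine (monomial_mem_span_iff k _ _).2 ⟨d, hd, ?_⟩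
      rw [← ha, ← funext hφ]
      exact exponentOf_restrict_le S φ
  · rintro _ ⟨_, ⟨S, α, h, rfl⟩, rfl⟩
    let N := ∑ g ∈ G, ∑ v ∈ g.support, (v + 1)
    obtain ⟨ψ, hψ, hle⟩ := exists_extension h.1 h.2.1 ⟨fun _ => N, monotone_const⟩
    obtain ⟨g, hg, hgψ⟩ := (monomial_mem_span_iff k _ _).1 (h.2.2 ψ hψ)
    refine (monomial_mem_span_iff k _ _).2 ⟨g, hg, fun v => ?_⟩
    by_cases hv : g v = 0
    · exact hv ▸ Nat.zero_le _
    have hvN : v < N := (Finset.single_le_sum (f := fun v => v + 1) (fun _ _ => Nat.zero_le _)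
      (Finsupp.mem_support_iff.2 hv)).trans (Finset.single_le_sum
        (f := fun g : ℕ →₀ ℕ => ∑ v ∈ g.support, (v + 1)) (fun _ _ => Nat.zero_le _) hg)
    refine (hgψ v).trans ?_
    rw [exponentOf_apply, exponentOf_apply]
    have hmem : ∀ p, ψ p = v → p ∈ S := fun p hp => by
      by_contra hpS
      exact absurd (hle p hpS) (not_le.2 (hp ▸ hvN))
    exact Fintype.card_le_of_injective
      (fun p => ⟨⟨p.1, hmem p.1 p.2⟩, (hψ ⟨p.1, hmem p.1 p.2⟩).symm.trans p.2⟩)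
      fun p q hpq => Subtype.ext (congrArg (fun x => x.1.1) hpq)

/-- The projected co-letterplace ideal `L^{p₂}([m],J)` of a poset ideal
`J ⊆ Hom([m],ℕ)` is a strongly stable ideal of `k[x_ℕ]` generated in degrees at most
`m` (hence `m`-regular), and `J ↦ L^{p₂}([m],J)` is a one-to-one correspondence
between poset ideals of `Hom([m],ℕ)` and finitely generated strongly stable ideals of
`k[x_ℕ]` generated in degrees at most `m`. -/
theorem projCoLetterplace_stronglyStable_correspondence (k : Type*) [Field k] (m : ℕ) :
    (∀ J : Set (Fin m →o ℕ), IsPosetIdeal J →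
      StronglyStableN k (projCoLetterplaceChain k m J) ∧
      GeneratedInDegreesLE k (projCoLetterplaceChain k m J) m) ∧
    (∀ J J' : Set (Fin m →o ℕ), IsPosetIdeal J → IsPosetIdeal J' →
      projCoLetterplaceChain k m J = projCoLetterplaceChain k m J' → J = J') ∧
    (∀ I : Ideal (MvPolynomial ℕ k), StronglyStableN k I → GeneratedInDegreesLE k I m →
      ∃ J : Set (Fin m →o ℕ), IsPosetIdeal J ∧ I = projCoLetterplaceChain k m J) := by
  refine ⟨fun J hJ => ⟨stronglyStableN_projCoLetterplaceChain k m hJ,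
    generatedInDegreesLE_projCoLetterplaceChain k m hJ⟩, fun J J' hJ hJ' h => ?_,
    fun I hI hgen => ⟨isotoneMapsOf k m I, fun φ hφ ψ hψ => hI.monomial_exponentOf_mem hψ hφ,
      eq_projCoLetterplaceChain_isotoneMapsOf k m hgen⟩⟩
  ext φ
  rw [← monomial_exponentOf_mem_projCoLetterplaceChain_iff k m hJ, h,
    monomial_exponentOf_mem_projCoLetterplaceChain_iff k m hJ']
end
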